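/- Let ζ be an extremal number. Then ŵ_3(ζ) = 3 and λ̂_3(ζ) = 1/3. -/

import Mathlib

open Polynomial

/-- Height of an integer polynomial: the maximum absolute value of its coefficients. -/
noncomputable def polyH (P : Polynomial ℤ) : ℝ :=
  (((P.support.sup fun i => (P.coeff i).natAbs) : ℕ) : ℝ)

/-- Evaluation of an integer polynomial at a real number. -/
noncomputable def pev (ζ : ℝ) (P : Polynomial ℤ) : ℝ := Polynomial.aeval ζ P

/-- Set of exponents η such that for arbitrarily large X the system
    H(P) ≤ X, 0 < |P(ζ)| ≤ X^(−η) has a solution of degree at most n. -/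
def wSet (n : ℕ) (ζ : ℝ) : Set ℝ :=
  {η | ∀ X₀ : ℝ, ∃ X : ℝ, X₀ ≤ X ∧ ∃ P : Polynomial ℤ,
    P.natDegree ≤ n ∧ polyH P ≤ X ∧ 0 < |pev ζ P| ∧ |pev ζ P| ≤ X ^ (-η)}

/-- The exponent w_n(ζ). -/
noncomputable def wExp (n : ℕ) (ζ : ℝ) : ℝ := sSup (wSet n ζ)

/-- Set of exponents η such that for all sufficiently large X the system
    H(P) ≤ X, 0 < |P(ζ)| ≤ X^(−η) has a solution of degree at most n. -/
def whSet (n : ℕ) (ζ : ℝ) : Set ℝ :=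
  {η | ∃ X₀ : ℝ, ∀ X : ℝ, X₀ ≤ X → ∃ P : Polynomial ℤ,
    P.natDegree ≤ n ∧ polyH P ≤ X ∧ 0 < |pev ζ P| ∧ |pev ζ P| ≤ X ^ (-η)}

/-- The uniform exponent ŵ_n(ζ). -/
noncomputable def whExp (n : ℕ) (ζ : ℝ) : ℝ := sSup (whSet n ζ)

/-- Set of exponents η such that for arbitrarily large X the system
    |x| ≤ X, max_{1≤i≤n} |ζ^i x − y_i| ≤ X^(−η) has a nonzero integer solution. -/
def lamSet (n : ℕ) (ζ : ℝ) : Set ℝ :=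
  {η | ∀ X₀ : ℝ, ∃ X : ℝ, X₀ ≤ X ∧ ∃ x : ℤ, ∃ y : Fin n → ℤ,
    (x ≠ 0 ∨ y ≠ 0) ∧ ((|x| : ℤ) : ℝ) ≤ X ∧
    ∀ i : Fin n, |ζ ^ ((i : ℕ) + 1) * (x : ℝ) - (y i : ℝ)| ≤ X ^ (-η)}

/-- The exponent λ_n(ζ). -/
noncomputable def lamExp (n : ℕ) (ζ : ℝ) : ℝ := sSup (lamSet n ζ)

/-- Set of exponents η such that for all sufficiently large X the system
    |x| ≤ X, max_{1≤i≤n} |ζ^i x − y_i| ≤ X^(−η) has a nonzero integer solution. -/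
def lamhSet (n : ℕ) (ζ : ℝ) : Set ℝ :=
  {η | ∃ X₀ : ℝ, ∀ X : ℝ, X₀ ≤ X → ∃ x : ℤ, ∃ y : Fin n → ℤ,
    (x ≠ 0 ∨ y ≠ 0) ∧ ((|x| : ℤ) : ℝ) ≤ X ∧
    ∀ i : Fin n, |ζ ^ ((i : ℕ) + 1) * (x : ℝ) - (y i : ℝ)| ≤ X ^ (-η)}

/-- The uniform exponent λ̂_n(ζ). -/
noncomputable def lamhExp (n : ℕ) (ζ : ℝ) : ℝ := sSup (lamhSet n ζ)

/-- Set of exponents η such that for arbitrarily large X the polynomial system has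
    at least j linearly independent solutions of degree at most n. -/
def wSetJ (n j : ℕ) (ζ : ℝ) : Set ℝ :=
  {η | ∀ X₀ : ℝ, ∃ X : ℝ, X₀ ≤ X ∧ ∃ P : Fin j → Polynomial ℤ,
    LinearIndependent ℤ P ∧ ∀ i : Fin j,
      (P i).natDegree ≤ n ∧ polyH (P i) ≤ X ∧ 0 < |pev ζ (P i)| ∧ |pev ζ (P i)| ≤ X ^ (-η)}

/-- The exponent w_{n,j}(ζ). -/
noncomputable def wExpJ (n j : ℕ) (ζ : ℝ) : ℝ := sSup (wSetJ n j ζ)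

/-- Set of exponents η such that for all sufficiently large X the polynomial system has
    at least j linearly independent solutions of degree at most n. -/
def whSetJ (n j : ℕ) (ζ : ℝ) : Set ℝ :=
  {η | ∃ X₀ : ℝ, ∀ X : ℝ, X₀ ≤ X → ∃ P : Fin j → Polynomial ℤ,
    LinearIndependent ℤ P ∧ ∀ i : Fin j,
      (P i).natDegree ≤ n ∧ polyH (P i) ≤ X ∧ 0 < |pev ζ (P i)| ∧ |pev ζ (P i)| ≤ X ^ (-η)}

/-- The uniform exponent ŵ_{n,j}(ζ). -/
noncomputable def whExpJ (n j : ℕ) (ζ : ℝ) : ℝ := sSup (whSetJ n j ζ)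

/-- Set of exponents η such that for arbitrarily large X the simultaneous approximation
    system has at least j linearly independent integer vector solutions. -/
def lamSetJ (n j : ℕ) (ζ : ℝ) : Set ℝ :=
  {η | ∀ X₀ : ℝ, ∃ X : ℝ, X₀ ≤ X ∧ ∃ v : Fin j → (Fin (n + 1) → ℤ),
    LinearIndependent ℤ v ∧ ∀ i : Fin j,
      ((|v i 0| : ℤ) : ℝ) ≤ X ∧
      ∀ t : Fin n, |ζ ^ ((t : ℕ) + 1) * ((v i 0 : ℤ) : ℝ) - ((v i t.succ : ℤ) : ℝ)| ≤ X ^ (-η)}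

/-- The exponent λ_{n,j}(ζ). -/
noncomputable def lamExpJ (n j : ℕ) (ζ : ℝ) : ℝ := sSup (lamSetJ n j ζ)

/-- Set of exponents η such that for all sufficiently large X the simultaneous approximation
    system has at least j linearly independent integer vector solutions. -/
def lamhSetJ (n j : ℕ) (ζ : ℝ) : Set ℝ :=
  {η | ∃ X₀ : ℝ, ∀ X : ℝ, X₀ ≤ X → ∃ v : Fin j → (Fin (n + 1) → ℤ),
    LinearIndependent ℤ v ∧ ∀ i : Fin j,
      ((|v i 0| : ℤ) : ℝ) ≤ X ∧
      ∀ t : Fin n, |ζ ^ ((t : ℕ) + 1) * ((v i 0 : ℤ) : ℝ) - ((v i t.succ : ℤ) : ℝ)| ≤ X ^ (-η)}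

/-- The uniform exponent λ̂_{n,j}(ζ). -/
noncomputable def lamhExpJ (n j : ℕ) (ζ : ℝ) : ℝ := sSup (lamhSetJ n j ζ)

/-- An extremal number: a real transcendental number with ŵ₂(ζ) = (3+√5)/2. -/
def IsExtremal (ζ : ℝ) : Prop :=
  Transcendental ℚ ζ ∧ whExp 2 ζ = (3 + Real.sqrt 5) / 2

/-- The quadratic form `x₀ x₂ - x₁²` on integer triples. -/
def conic (x : Fin 3 → ℤ) : ℤ := x 0 * x 2 - x 1 ^ 2

/-- The value at `ζ` of the polynomial of degree at most two with coefficient vector `P`. -/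
noncomputable def quadEval (ζ : ℝ) (P : Fin 3 → ℤ) : ℝ := P 0 + P 1 * ζ + P 2 * ζ ^ 2

open scoped Matrix

lemma cross_zero' (P Q : Fin 3 → ℤ) : (P ⨯₃ Q) 0 = P 1 * Q 2 - P 2 * Q 1 := by
  simp [cross_apply]

lemma cross_one' (P Q : Fin 3 → ℤ) : (P ⨯₃ Q) 1 = P 2 * Q 0 - P 0 * Q 2 := by
  simp [cross_apply]

lemma cross_two' (P Q : Fin 3 → ℤ) : (P ⨯₃ Q) 2 = P 0 * Q 1 - P 1 * Q 0 := by
  simp [cross_apply]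

lemma abs_cross_le {P Q : Fin 3 → ℤ} {a b : ℝ} (hP : ∀ k, |(P k : ℝ)| ≤ a)
    (hQ : ∀ k, |(Q k : ℝ)| ≤ b) (k : Fin 3) : |((P ⨯₃ Q) k : ℝ)| ≤ 2 * a * b := by
  have ha : 0 ≤ a := (abs_nonneg _).trans (hP 0)
  have key : ∀ i j : Fin 3, |(P i : ℝ) * Q j - P j * Q i| ≤ 2 * a * b := by
    intro i j
    have h1 : |(P i : ℝ) * Q j| ≤ a * b := by
      rw [abs_mul]; exact mul_le_mul (hP i) (hQ j) (abs_nonneg _) ha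
    have h2 : |(P j : ℝ) * Q i| ≤ a * b := by
      rw [abs_mul]; exact mul_le_mul (hP j) (hQ i) (abs_nonneg _) ha
    have := abs_sub ((P i : ℝ) * Q j) (P j * Q i)
    linarith
  fin_cases k
  · simpa [cross_apply] using key 1 2
  · simpa [cross_apply] using key 2 0
  · simpa [cross_apply] using key 0 1

lemma abs_mul_sub_mul_le {a b p q l m : ℝ} (hp : |p| ≤ a) (hq : |q| ≤ b)
    {x y : ℝ} (hx : |x| ≤ l) (hy : |y| ≤ m) (hab : a ≤ b) (hml : m ≤ l) :
    |q * x - p * y| ≤ 2 * b * l := by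
  have hb : 0 ≤ b := (abs_nonneg _).trans hq
  have hl : 0 ≤ l := (abs_nonneg _).trans hx
  have h1 : |q * x| ≤ b * l := by
    rw [abs_mul]; exact mul_le_mul hq hx (abs_nonneg _) hb
  have h2 : |p * y| ≤ b * l := by
    rw [abs_mul]; exact mul_le_mul (hp.trans hab) (hy.trans hml) (abs_nonneg _) hb
  have := abs_sub (q * x) (p * y)
  linarith

lemma cross_dev_fst {ζ a b l m : ℝ} {P Q : Fin 3 → ℤ} (hP : ∀ k, |(P k : ℝ)| ≤ a)
    (hQ : ∀ k, |(Q k : ℝ)| ≤ b) (hPl : |quadEval ζ P| ≤ l) (hQm : |quadEval ζ Q| ≤ m)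
    (hab : a ≤ b) (hml : m ≤ l) :
    |ζ * (P ⨯₃ Q) 0 - (P ⨯₃ Q) 1| ≤ 2 * b * l := by
  have := abs_mul_sub_mul_le (hP 2) (hQ 2) hPl hQm hab hml
  convert this using 2
  rw [cross_zero', cross_one', quadEval, quadEval]
  push_cast
  ring

lemma cross_dev_snd {ζ a b l m : ℝ} (hζ : ζ ≠ 0) {P Q : Fin 3 → ℤ} (hP : ∀ k, |(P k : ℝ)| ≤ a)
    (hQ : ∀ k, |(Q k : ℝ)| ≤ b) (hPl : |quadEval ζ P| ≤ l) (hQm : |quadEval ζ Q| ≤ m)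
    (hab : a ≤ b) (hml : m ≤ l) :
    |ζ * (P ⨯₃ Q) 1 - (P ⨯₃ Q) 2| ≤ 2 * b * l / |ζ| := by
  have := abs_mul_sub_mul_le (hP 0) (hQ 0) hPl hQm hab hml
  have h : (ζ * (P ⨯₃ Q) 1 - (P ⨯₃ Q) 2) * ζ = Q 0 * quadEval ζ P - P 0 * quadEval ζ Q := by
    rw [cross_two', cross_one', quadEval, quadEval]
    push_cast
    ring
  rwa [le_div_iff₀ (abs_pos.mpr hζ), ← abs_mul, h]

/-- Two integer triples orthogonal to two vectors with nonzero cross product are parallel to it. -/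
lemma cross_parallel {P Q x : Fin 3 → ℤ} (hP : x ⬝ᵥ P = 0) (hQ : x ⬝ᵥ Q = 0) :
    x 0 * (P ⨯₃ Q) 1 = x 1 * (P ⨯₃ Q) 0 ∧ x 0 * (P ⨯₃ Q) 2 = x 2 * (P ⨯₃ Q) 0 ∧
      x 1 * (P ⨯₃ Q) 2 = x 2 * (P ⨯₃ Q) 1 := by
  rw [cross_zero', cross_one', cross_two']
  simp only [dotProduct, Fin.sum_univ_three] at hP hQ
  refine ⟨?_, ?_, ?_⟩
  · linear_combination Q 2 * (-hP) + P 2 * hQ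
  · linear_combination Q 1 * hP - P 1 * hQ
  · linear_combination - Q 0 * hP + P 0 * hQ

lemma dot_eq_zero_of_parallel {x y S : Fin 3 → ℤ} (hy : y ≠ 0) (h01 : x 0 * y 1 = x 1 * y 0)
    (h02 : x 0 * y 2 = x 2 * y 0) (h12 : x 1 * y 2 = x 2 * y 1) (hS : y ⬝ᵥ S = 0) :
    x ⬝ᵥ S = 0 := by
  simp only [dotProduct, Fin.sum_univ_three] at hS ⊢
  have h : ∀ k, y k * (x 0 * S 0 + x 1 * S 1 + x 2 * S 2) = 0 := by
    intro k
    fin_cases k <;> simp only [Fin.zero_eta, Fin.mk_one, Fin.reduceFinMk]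
    · linear_combination x 0 * hS - S 1 * h01 - S 2 * h02
    · linear_combination x 1 * hS + S 0 * h01 - S 2 * h12
    · linear_combination x 2 * hS + S 0 * h02 + S 1 * h12
  by_contra hne
  exact hy (funext fun k => by simpa [hne] using h k)

/-- For parallel triples `x`, `y`, the polarisation `x₀ y₂ - x₁ y₁` vanishes only trivially. -/
lemma conic_polar_ne_zero {x y : Fin 3 → ℤ} (hx : conic x ≠ 0) (hy : y ≠ 0)
    (h01 : x 0 * y 1 = x 1 * y 0)
    (h02 : x 0 * y 2 = x 2 * y 0) (h12 : x 1 * y 2 = x 2 * y 1) :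
    x 0 * y 2 - x 1 * y 1 ≠ 0 := by
  intro h0
  have h : ∀ k, y k * conic x = 0 := by
    intro k
    unfold conic
    fin_cases k <;> simp only [Fin.zero_eta, Fin.mk_one, Fin.reduceFinMk]
    · linear_combination x 0 * h0 - x 0 * h02 + x 1 * h01
    · linear_combination x 1 * h0 - x 0 * h12
    · linear_combination x 2 * h0 - x 1 * h12
  exact hy (funext fun k => by simpa [hx] using h k)

lemma conic_ne_zero_of_parallel {x y : Fin 3 → ℤ} (hx : conic x ≠ 0) (hy : y ≠ 0)
    (h01 : x 0 * y 1 = x 1 * y 0)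
    (h02 : x 0 * y 2 = x 2 * y 0) (h12 : x 1 * y 2 = x 2 * y 1) :
    conic y ≠ 0 := by
  intro h0
  apply conic_polar_ne_zero hx hy h01 h02 h12
  have : (x 0 * y 2 - x 1 * y 1) ^ 2 = conic x * conic y := by
    unfold conic
    linear_combination x 0 * y 2 * h02 - x 0 * y 1 * h12 - x 1 * y 2 * h01
  rw [h0, mul_zero] at this
  exact pow_eq_zero_iff (two_ne_zero) |>.mp this

lemma one_le_of_parallel {ζ A B : ℝ} {x y : Fin 3 → ℤ} (hx : conic x ≠ 0) (hy : y ≠ 0)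
    (h01 : x 0 * y 1 = x 1 * y 0)
    (h02 : x 0 * y 2 = x 2 * y 0) (h12 : x 1 * y 2 = x 2 * y 1)
    (hA : ∀ k, |(x k : ℝ)| ≤ A) (hB1 : |ζ * y 0 - y 1| ≤ B) (hB2 : |ζ * y 1 - y 2| ≤ B) :
    1 ≤ 2 * A * B := by
  have h1 : (1 : ℝ) ≤ |((x 0 * y 2 - x 1 * y 1 : ℤ) : ℝ)| := by
    rw [← Int.cast_abs]
    exact_mod_cast Int.one_le_abs (conic_polar_ne_zero hx hy h01 h02 h12)
  have h01' : (x 0 : ℝ) * y 1 = x 1 * y 0 := by exact_mod_cast h01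
  have h2 : ((x 0 * y 2 - x 1 * y 1 : ℤ) : ℝ) =
      x 1 * (ζ * y 0 - y 1) - x 0 * (ζ * y 1 - y 2) := by
    push_cast
    linear_combination ζ * h01'
  rw [h2] at h1
  have := abs_mul_sub_mul_le (hA 0) (hA 1) hB1 hB2 le_rfl le_rfl
  linarith

lemma abs_dot_le {ζ A B H l : ℝ} {x S : Fin 3 → ℤ} (hA : |(x 0 : ℝ)| ≤ A)
    (hB1 : |ζ * x 0 - x 1| ≤ B) (hB2 : |ζ * x 1 - x 2| ≤ B) (hS : ∀ k, |(S k : ℝ)| ≤ H)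
    (hl : |quadEval ζ S| ≤ l) :
    |((x ⬝ᵥ S : ℤ) : ℝ)| ≤ A * l + H * B * (2 + |ζ|) := by
  have hH : 0 ≤ H := (abs_nonneg _).trans (hS 0)
  have hA0 : 0 ≤ A := (abs_nonneg _).trans hA
  have hB0 : 0 ≤ B := (abs_nonneg _).trans hB1
  have h : ((x ⬝ᵥ S : ℤ) : ℝ) = x 0 * quadEval ζ S - S 1 * (ζ * x 0 - x 1)
      - S 2 * (ζ * x 1 - x 2) - S 2 * (ζ * x 0 - x 1) * ζ := by
    simp only [dotProduct, Fin.sum_univ_three, quadEval]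
    push_cast
    ring
  have t1 : |x 0 * quadEval ζ S| ≤ A * l := by
    rw [abs_mul]; exact mul_le_mul hA hl (abs_nonneg _) hA0
  have t2 : |S 1 * (ζ * x 0 - x 1)| ≤ H * B := by
    rw [abs_mul]; exact mul_le_mul (hS 1) hB1 (abs_nonneg _) hH
  have t3 : |S 2 * (ζ * x 1 - x 2)| ≤ H * B := by
    rw [abs_mul]; exact mul_le_mul (hS 2) hB2 (abs_nonneg _) hH
  have t4 : |S 2 * (ζ * x 0 - x 1) * ζ| ≤ H * B * |ζ| := by
    rw [abs_mul, abs_mul]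
    exact mul_le_mul_of_nonneg_right
      (mul_le_mul (hS 2) hB1 (abs_nonneg _) hH) (abs_nonneg _)
  rw [h]
  have s1 := abs_sub (x 0 * quadEval ζ S - S 1 * (ζ * x 0 - x 1)
      - S 2 * (ζ * x 1 - x 2)) (S 2 * (ζ * x 0 - x 1) * ζ)
  have s2 := abs_sub (x 0 * quadEval ζ S - S 1 * (ζ * x 0 - x 1)) (S 2 * (ζ * x 1 - x 2))
  have s3 := abs_sub (x 0 * quadEval ζ S) (S 1 * (ζ * x 0 - x 1))
  linarith

lemma cross_ne_zero_of_lt {ζ : ℝ} {P Q : Fin 3 → ℤ} {a : ℝ} (hP : ∀ k, |(P k : ℝ)| ≤ a)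
    (hQ : ∃ k, a < |(Q k : ℝ)|) (h0 : quadEval ζ P ≠ 0)
    (hlt : |quadEval ζ Q| ≤ |quadEval ζ P|) : P ⨯₃ Q ≠ 0 := by
  intro h
  have e0 := cross_zero' P Q
  have e1 := cross_one' P Q
  have e2 := cross_two' P Q
  simp only [h, Pi.zero_apply] at e0 e1 e2
  have e0' : (P 1 : ℝ) * Q 2 = P 2 * Q 1 := by exact_mod_cast (sub_eq_zero.mp e0.symm)
  have e1' : (P 2 : ℝ) * Q 0 = P 0 * Q 2 := by exact_mod_cast (sub_eq_zero.mp e1.symm)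
  have e2' : (P 0 : ℝ) * Q 1 = P 1 * Q 0 := by exact_mod_cast (sub_eq_zero.mp e2.symm)
  have key : ∀ k, (Q k : ℝ) * quadEval ζ P = P k * quadEval ζ Q := by
    intro k
    unfold quadEval
    fin_cases k <;> simp
    · linear_combination - ζ * e2' + ζ ^ 2 * e1'
    · linear_combination e2' - ζ ^ 2 * e0'
    · linear_combination - e1' + ζ * e0'
  obtain ⟨k, hk⟩ := hQ
  have h1 : |(Q k : ℝ)| * |quadEval ζ P| = |(P k : ℝ)| * |quadEval ζ Q| := by
    rw [← abs_mul, ← abs_mul, key k]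
  have hp : 0 < |quadEval ζ P| := abs_pos.mpr h0
  have h2 : |(P k : ℝ)| * |quadEval ζ Q| ≤ a * |quadEval ζ P| :=
    mul_le_mul (hP k) hlt (abs_nonneg _) ((abs_nonneg _).trans (hP k))
  rw [← h1] at h2
  exact absurd (le_of_mul_le_mul_right h2 hp) (not_le.mpr hk)

open Filter Real

/-- A sequence of integer polynomials of degree at most two with growing heights and decreasing
values at `ζ`, realising uniform approximation of every order below `φ² = φ + 1`. -/
structure ApproxSeq (ζ : ℝ) where
  p : ℕ → Fin 3 → ℤ
  H : ℕ → ℕ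
  H_pos : ∀ n, 0 < H n
  H_strictMono : StrictMono H
  abs_le : ∀ n k, |(p n k : ℝ)| ≤ H n
  exists_le : ∀ n, ∃ k, (H n : ℝ) ≤ |(p n k : ℝ)|
  eval_ne : ∀ n, quadEval ζ (p n) ≠ 0
  anti : Antitone fun n => |quadEval ζ (p n)|
  uniform : ∀ θ < goldenRatio + 1, ∀ᶠ n in atTop,
    |quadEval ζ (p n)| ≤ (H (n + 1) : ℝ) ^ (-θ)

lemma log_four_nonneg {a b c d : ℝ} (ha : 0 < a) (hb : 0 < b) (hc : 0 < c) (hd : 0 < d)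
    (h : 1 ≤ a * b * c * d) : 0 ≤ log a + log b + log c + log d := by
  rw [← log_mul ha.ne' hb.ne', ← log_mul (by positivity) hc.ne',
    ← log_mul (by positivity) hd.ne']
  exact log_nonneg h

lemma exists_pos_le_abs_mul_sub {ζ : ℝ} (hζ : Irrational ζ) (N : ℕ) :
    ∃ c : ℝ, 0 < c ∧ ∀ u v : ℤ, u ≠ 0 → |(u : ℝ)| ≤ N → c ≤ |ζ * u - v| := by
  have hF : (0 : ℝ) < (N.factorial : ℝ) := by exact_mod_cast N.factorial_pos
  have hpos : 0 < |(N.factorial : ℝ) * ζ - round ((N.factorial : ℝ) * ζ)| := by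
    rw [abs_pos, sub_ne_zero]
    exact (hζ.natCast_mul N.factorial_ne_zero).ne_int _
  refine ⟨|(N.factorial : ℝ) * ζ - round ((N.factorial : ℝ) * ζ)| / N.factorial,
    div_pos hpos hF, ?_⟩
  intro u v hu huN
  rw [div_le_iff₀ hF]
  have hN : u.natAbs ≤ N := by
    have : ((u.natAbs : ℕ) : ℝ) ≤ N := by rwa [Nat.cast_natAbs, Int.cast_abs]
    exact_mod_cast this
  have hdvd : u ∣ (N.factorial : ℤ) :=
    Int.natAbs_dvd_natAbs.mp (by
      simpa using Nat.dvd_factorial (Int.natAbs_pos.mpr hu) hN)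
  obtain ⟨w, hw⟩ := hdvd
  have hw' : (N.factorial : ℝ) = u * w := by exact_mod_cast hw
  have hu1 : (1 : ℝ) ≤ |(u : ℝ)| := by
    rw [← Int.cast_abs]; exact_mod_cast Int.one_le_abs hu
  refine (round_le _ (w * v)).trans ?_
  have h1 : (N.factorial : ℝ) * ζ - ((w * v : ℤ) : ℝ) = w * (ζ * u - v) := by
    rw [hw']; push_cast; ring
  have h2 : |(w : ℝ)| ≤ N.factorial := by
    rw [← abs_of_pos hF, hw', abs_mul]
    nlinarith [abs_nonneg (w : ℝ)]
  rw [h1, abs_mul, mul_comm]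
  exact mul_le_mul_of_nonneg_left h2 (abs_nonneg _)

/-- An integer triple on the cone `x₀ x₂ = x₁²` with `x₀ ≠ 0` is a multiple of `(u², uv, v²)`. -/
lemma exists_param_of_conic_eq_zero {x : Fin 3 → ℤ} (hx : conic x = 0) (h0 : x 0 ≠ 0) :
    ∃ u v g : ℤ, u ≠ 0 ∧ IsCoprime u v ∧ x 0 = g * u ∧ x 1 = g * v ∧ |u| ≤ |g| ∧
      u * x 2 = g * v ^ 2 := by
  obtain ⟨g, u, v, hg, hco, h1, h2⟩ := Int.exists_gcd_one' (m := x 0) (n := x 1)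
    (Nat.pos_of_ne_zero fun h => h0 (Int.gcd_eq_zero_iff.mp h).1)
  have hg' : (g : ℤ) ≠ 0 := by positivity
  have hu : u ≠ 0 := by
    rintro rfl
    exact h0 (by simpa using h1)
  have hcop : IsCoprime u v := Int.isCoprime_iff_gcd_eq_one.mpr hco
  have hux : u * x 2 = g * v ^ 2 := by
    unfold conic at hx
    have : (g : ℤ) * (u * x 2) = g * (g * v ^ 2) := by
      linear_combination hx - x 2 * h1 + (x 1 + v * g) * h2
    exact mul_left_cancel₀ hg' this
  have hdvd : u ∣ g := by
    have : u ∣ g * v ^ 2 := ⟨x 2, hux.symm⟩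
    exact (hcop.pow_right (n := 2)).dvd_of_dvd_mul_right this
  refine ⟨u, v, g, hu, hcop, by rw [h1]; ring, by rw [h2]; ring, ?_, hux⟩
  exact Int.le_of_dvd (abs_pos.mpr hg') (abs_dvd_abs _ _ |>.mpr hdvd)

/-- The homogenised value of a quadratic polynomial. -/
def homEval (P : Fin 3 → ℤ) (u v : ℤ) : ℤ := P 0 * u ^ 2 + P 1 * (u * v) + P 2 * v ^ 2

lemma homEval_eq_zero_of_dot {x P : Fin 3 → ℤ} {u v g : ℤ} (hg : g ≠ 0)
    (h0 : x 0 = g * u) (h1 : x 1 = g * v) (h2 : u * x 2 = g * v ^ 2) (h : x ⬝ᵥ P = 0) :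
    homEval P u v = 0 := by
  simp only [dotProduct, Fin.sum_univ_three] at h
  have : g * homEval P u v = 0 := by
    unfold homEval
    linear_combination u * h - u * P 0 * h0 - u * P 1 * h1 - P 2 * h2
  exact (mul_eq_zero.mp this).resolve_left hg

lemma abs_le_of_homEval_eq_zero {P : Fin 3 → ℤ} {u v : ℤ} (huv : IsCoprime u v)
    {H : ℝ} (hH : ∀ k, |(P k : ℝ)| ≤ H) (hP : P ≠ 0) (hu : u ≠ 0) (h : homEval P u v = 0) :
    |(u : ℝ)| ≤ H := by
  have aux : ∀ k, P k ≠ 0 → u ∣ P k → |(u : ℝ)| ≤ H := by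
    intro k hk hd
    refine le_trans ?_ (hH k)
    rw [← Int.cast_abs, ← Int.cast_abs]
    exact_mod_cast Int.le_of_dvd (abs_pos.mpr hk) (abs_dvd_abs _ _ |>.mpr hd)
  unfold homEval at h
  by_cases h2 : P 2 = 0
  · by_cases h1 : P 1 = 0
    · have h0 : P 0 = 0 := by simpa [h1, h2, hu] using h
      exact absurd (_root_.funext fun k => by fin_cases k <;> simpa) hP
    · refine aux 1 h1 (huv.dvd_of_dvd_mul_right (z := v) ⟨-P 0, ?_⟩)
      refine mul_left_cancel₀ hu ?_
      rw [h2] at h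
      linear_combination h
  · refine aux 2 h2 ((huv.pow_right (n := 2)).dvd_of_dvd_mul_right (z := v ^ 2)
      ⟨-(P 0 * u + P 1 * v), ?_⟩)
    linear_combination h

lemma one_le_of_homEval_ne_zero {ζ H l d : ℝ} {P : Fin 3 → ℤ} {u v : ℤ}
    (hH : ∀ k, |(P k : ℝ)| ≤ H) (hl : |quadEval ζ P| ≤ l) (h : homEval P u v ≠ 0)
    (hu : u ≠ 0) (hd : |(u : ℝ)| * |ζ * u - v| ≤ d) (hd1 : d ≤ 1) :
    1 ≤ (u : ℝ) ^ 2 * l + H * d * (2 + 2 * |ζ|) := by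
  have hH0 : 0 ≤ H := (abs_nonneg _).trans (hH 0)
  have h1 : (1 : ℝ) ≤ |((homEval P u v : ℤ) : ℝ)| := by
    rw [← Int.cast_abs]
    exact_mod_cast Int.one_le_abs h
  have hu1 : (1 : ℝ) ≤ |(u : ℝ)| := by
    rw [← Int.cast_abs]; exact_mod_cast Int.one_le_abs hu
  set e : ℝ := ζ * u - v with he
  have hed : |e| ≤ d := le_trans (by nlinarith [abs_nonneg e]) hd
  have hd0 : 0 ≤ d := (abs_nonneg _).trans hed
  have hexp : ((homEval P u v : ℤ) : ℝ) =
      u ^ 2 * quadEval ζ P - P 1 * (u * e) - P 2 * (2 * ζ * (u * e)) + P 2 * (e * e) := by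
    unfold homEval quadEval
    rw [he]
    push_cast
    ring
  have hue : |(u : ℝ) * e| ≤ d := by rwa [abs_mul]
  have t1 : |(u : ℝ) ^ 2 * quadEval ζ P| ≤ u ^ 2 * l := by
    rw [abs_mul, abs_of_nonneg (sq_nonneg (u : ℝ))]
    exact mul_le_mul_of_nonneg_left hl (sq_nonneg _)
  have t2 : |(P 1 : ℝ) * (u * e)| ≤ H * d := by
    rw [abs_mul]; exact mul_le_mul (hH 1) hue (abs_nonneg _) hH0
  have t3 : |(P 2 : ℝ) * (2 * ζ * (u * e))| ≤ H * (2 * |ζ| * d) := by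
    rw [abs_mul, abs_mul (2 * ζ), abs_mul 2 ζ, abs_two]
    refine mul_le_mul (hH 2) (mul_le_mul_of_nonneg_left hue (by positivity)) (by positivity) hH0
  have t4 : |(P 2 : ℝ) * (e * e)| ≤ H * d := by
    rw [abs_mul]
    refine mul_le_mul (hH 2) ?_ (abs_nonneg _) hH0
    rw [abs_mul]
    nlinarith [abs_nonneg e]
  rw [hexp] at h1
  have s1 := abs_add_le (u ^ 2 * quadEval ζ P - P 1 * (u * e) - P 2 * (2 * ζ * (u * e)))
    (P 2 * (e * e))
  have s2 := abs_sub (u ^ 2 * quadEval ζ P - P 1 * (u * e)) (P 2 * (2 * ζ * (u * e)))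
  have s3 := abs_sub (u ^ 2 * quadEval ζ P) (P 1 * (u * e))
  nlinarith

namespace ApproxSeq

variable {ζ : ℝ} (s : ApproxSeq ζ)

/-- The absolute value at `ζ` of the `n`-th polynomial. -/
noncomputable def L (n : ℕ) : ℝ := |quadEval ζ (s.p n)|

/-- The logarithmic height. -/
noncomputable def h (n : ℕ) : ℝ := log (s.H n)

/-- The cross product of two members of the sequence. -/
def cr (i j : ℕ) : Fin 3 → ℤ := s.p i ⨯₃ s.p j

/-- Three consecutive members are linearly independent. -/
def Indep (n : ℕ) : Prop := s.cr n (n + 1) ⬝ᵥ s.p (n + 2) ≠ 0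

lemma L_pos (n : ℕ) : 0 < s.L n := abs_pos.mpr (s.eval_ne n)

lemma L_anti {m n : ℕ} (hmn : m ≤ n) : s.L n ≤ s.L m := s.anti hmn

lemma one_le_H (n : ℕ) : (1 : ℝ) ≤ s.H n := by exact_mod_cast s.H_pos n

lemma H_pos' (n : ℕ) : (0 : ℝ) < s.H n := by exact_mod_cast s.H_pos n

lemma H_le {m n : ℕ} (hmn : m ≤ n) : (s.H m : ℝ) ≤ s.H n := by
  exact_mod_cast s.H_strictMono.monotone hmn

lemma h_nonneg (n : ℕ) : 0 ≤ s.h n := log_nonneg (s.one_le_H n)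

lemma h_mono {m n : ℕ} (hmn : m ≤ n) : s.h m ≤ s.h n := log_le_log (s.H_pos' m) (s.H_le hmn)

lemma tendsto_H : Tendsto (fun n => (s.H n : ℝ)) atTop atTop :=
  tendsto_natCast_atTop_atTop.comp s.H_strictMono.tendsto_atTop

lemma tendsto_h : Tendsto s.h atTop atTop := tendsto_log_atTop.comp s.tendsto_H

lemma eventually_le_mul_h (C : ℝ) {ε : ℝ} (hε : 0 < ε) : ∀ᶠ n in atTop, C ≤ ε * s.h n :=
  (s.tendsto_h.const_mul_atTop hε).eventually_ge_atTop C

lemma eventually_log_L_le {ε : ℝ} (hε : 0 < ε) :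
    ∀ᶠ n in atTop, log (s.L n) ≤ -(goldenRatio + 1 - ε) * s.h (n + 1) := by
  filter_upwards [s.uniform (goldenRatio + 1 - ε) (by linarith)] with n hn
  have := log_le_log (s.L_pos n) hn
  rwa [log_rpow (s.H_pos' _)] at this

lemma tendsto_sq_mul_L : Tendsto (fun n => (s.H (n + 1) : ℝ) ^ 2 * s.L n) atTop (nhds 0) := by
  have h1 : Tendsto (fun n => ((s.H (n + 1) : ℝ)) ^ (-(1 / 2 : ℝ))) atTop (nhds 0) :=
    (tendsto_rpow_neg_atTop (by norm_num)).comp (s.tendsto_H.comp (tendsto_add_atTop_nat 1))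
  refine squeeze_zero' (Eventually.of_forall fun n => ?_) ?_ h1
  · have := s.L_pos n
    positivity
  · have hφ : (5 / 2 : ℝ) < goldenRatio + 1 := by
      have h5 : (2 : ℝ) < √5 := by
        rw [lt_sqrt (by norm_num)]; norm_num
      unfold goldenRatio
      linarith
    filter_upwards [s.uniform (5 / 2) hφ] with n hn
    have hH := s.H_pos' (n + 1)
    calc (s.H (n + 1) : ℝ) ^ 2 * s.L n
        ≤ (s.H (n + 1) : ℝ) ^ 2 * (s.H (n + 1) : ℝ) ^ (-(5 / 2) : ℝ) :=
          mul_le_mul_of_nonneg_left hn (by positivity)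
      _ = (s.H (n + 1) : ℝ) ^ (-(1 / 2 : ℝ)) := by
          rw [← rpow_natCast, ← rpow_add hH]
          norm_num

lemma cr_ne_zero {i j : ℕ} (hij : i < j) : s.cr i j ≠ 0 := by
  obtain ⟨k, hk⟩ := s.exists_le j
  refine cross_ne_zero_of_lt (s.abs_le i) ⟨k, lt_of_lt_of_le ?_ hk⟩ (s.eval_ne i) (s.anti hij.le)
  exact_mod_cast s.H_strictMono hij

/-- The constant `1 + 1 / |ζ|`. -/
noncomputable def K (ζ : ℝ) : ℝ := 1 + 1 / |ζ|

lemma one_le_K (ζ : ℝ) : 1 ≤ K ζ := by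
  unfold K
  have : 0 ≤ 1 / |ζ| := by positivity
  linarith

lemma abs_cr_le (i j : ℕ) (k : Fin 3) : |(s.cr i j k : ℝ)| ≤ 2 * s.H i * s.H j :=
  abs_cross_le (s.abs_le i) (s.abs_le j) k

lemma cr_dev {i j : ℕ} (hζ : ζ ≠ 0) (hij : i ≤ j) :
    |ζ * s.cr i j 0 - s.cr i j 1| ≤ 2 * s.H j * s.L i * K ζ ∧
    |ζ * s.cr i j 1 - s.cr i j 2| ≤ 2 * s.H j * s.L i * K ζ := by
  have hH := s.H_pos' j
  have hL := s.L_pos i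
  have h1 := cross_dev_fst (ζ := ζ) (s.abs_le i) (s.abs_le j) le_rfl le_rfl (s.H_le hij)
    (s.L_anti hij)
  have h2 := cross_dev_snd hζ (s.abs_le i) (s.abs_le j) le_rfl le_rfl (s.H_le hij)
    (s.L_anti hij)
  have hz : 0 ≤ 1 / |ζ| := by positivity
  have h0 : 0 ≤ 2 * (s.H j : ℝ) * s.L i := by positivity
  refine ⟨h1.trans ?_, h2.trans ?_⟩
  · exact le_mul_of_one_le_right h0 (one_le_K ζ)
  · rw [div_eq_mul_one_div]
    exact mul_le_mul_of_nonneg_left (by unfold K; linarith) h0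

lemma cr_dot_left (i j : ℕ) : s.cr i j ⬝ᵥ s.p i = 0 := by
  unfold cr
  rw [dotProduct_comm, dot_self_cross]

lemma cr_dot_right (i j : ℕ) : s.cr i j ⬝ᵥ s.p j = 0 := by
  unfold cr
  rw [dotProduct_comm, dot_cross_self]

lemma cr_parallel {i m n : ℕ} (hm : s.cr i (i + 1) ⬝ᵥ s.p m = 0)
    (hn : s.cr i (i + 1) ⬝ᵥ s.p n = 0) :
    s.cr i (i + 1) 0 * s.cr m n 1 = s.cr i (i + 1) 1 * s.cr m n 0 ∧
    s.cr i (i + 1) 0 * s.cr m n 2 = s.cr i (i + 1) 2 * s.cr m n 0 ∧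
    s.cr i (i + 1) 1 * s.cr m n 2 = s.cr i (i + 1) 2 * s.cr m n 1 :=
  cross_parallel hm hn

lemma cr_dot_eq_zero {i : ℕ} {k : ℕ}
    (hJ : ∀ l, i ≤ l → l + 2 ≤ k → ¬ s.Indep l) (hik : i ≤ k) :
    s.cr i (i + 1) ⬝ᵥ s.p k = 0 := by
  induction k using Nat.strong_induction_on with
  | _ k ih =>
    rcases hik.eq_or_lt with rfl | hlt
    · exact s.cr_dot_left _ _
    rcases (Nat.succ_le_of_lt hlt).eq_or_lt with rfl | hlt2
    · exact s.cr_dot_right _ _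
    obtain ⟨l, rfl⟩ : ∃ l, k = l + 2 := ⟨k - 2, by omega⟩
    have h1 := ih l (by omega) (fun l' hl hl' => hJ l' hl (by omega)) (by omega)
    have h2 := ih (l + 1) (by omega) (fun l' hl hl' => hJ l' hl (by omega)) (by omega)
    obtain ⟨h01, h02, h12⟩ := s.cr_parallel h1 h2
    refine dot_eq_zero_of_parallel (s.cr_ne_zero (Nat.lt_succ_self l)) h01 h02 h12 ?_
    by_contra hne
    exact hJ l (by omega) le_rfl hne

lemma one_le_of_conic_ne_zero (hζ : ζ ≠ 0) {i m : ℕ} (hx : conic (s.cr i (i + 1)) ≠ 0)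
    (hm : s.cr i (i + 1) ⬝ᵥ s.p m = 0) (hn : s.cr i (i + 1) ⬝ᵥ s.p (m + 1) = 0) :
    1 ≤ 8 * K ζ * (s.H i * s.H (i + 1)) * s.H (m + 1) * s.L m := by
  obtain ⟨h01, h02, h12⟩ := s.cr_parallel hm hn
  obtain ⟨h1, h2⟩ := s.cr_dev hζ (Nat.le_succ m)
  have := one_le_of_parallel hx (s.cr_ne_zero (Nat.lt_succ_self m)) h01 h02 h12
    (s.abs_cr_le i (i + 1)) h1 h2
  refine this.trans (le_of_eq ?_)
  ring

lemma one_le_of_indep (hζ : ζ ≠ 0) {n : ℕ} (hn : s.Indep n) :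
    1 ≤ (2 + 2 * K ζ * (2 + |ζ|)) * s.H (n + 1) * s.H (n + 2) * s.L n := by
  obtain ⟨h1, h2⟩ := s.cr_dev hζ (Nat.le_succ n)
  have h3 := abs_dot_le (s.abs_cr_le n (n + 1) 0) h1 h2 (s.abs_le (n + 2))
    (l := s.L n) (s.L_anti (by omega))
  have h4 : (1 : ℝ) ≤ |((s.cr n (n + 1) ⬝ᵥ s.p (n + 2) : ℤ) : ℝ)| := by
    rw [← Int.cast_abs]
    exact_mod_cast Int.one_le_abs hn
  refine (h4.trans h3).trans ?_
  have h5 : (s.H n : ℝ) * (s.H (n + 1) * s.L n) ≤ s.H (n + 2) * (s.H (n + 1) * s.L n) :=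
    mul_le_mul_of_nonneg_right (s.H_le (by omega))
      (mul_nonneg (s.H_pos' _).le (s.L_pos _).le)
  simp only [Nat.succ_eq_add_one]
  linarith

lemma eventually_conic_ne_zero (hζ : Irrational ζ) :
    ∀ᶠ m in atTop, conic (s.cr m (m + 1)) ≠ 0 := by
  set C : ℝ := 2 * K ζ with hC
  have hC2 : 2 ≤ C := by have := one_le_K ζ; linarith
  set D : ℝ := 1 + C * (2 + 2 * |ζ|) with hD
  have hD1 : 1 ≤ D := by
    have : 0 ≤ C * (2 + 2 * |ζ|) := by positivity
    linarith
  have hDC : C ≤ D := by nlinarith [abs_nonneg ζ]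
  have hsmall : ∀ᶠ n in atTop, (s.H (n + 1) : ℝ) ^ 2 * s.L n < 1 / (2 * D) :=
    s.tendsto_sq_mul_L.eventually_lt_const (by positivity)
  obtain ⟨n₀, hn₀⟩ := eventually_atTop.mp hsmall
  obtain ⟨c, hc, hcu⟩ := exists_pos_le_abs_mul_sub hζ (s.H n₀)
  have hsmall2 : ∀ᶠ n in atTop, (s.H (n + 1) : ℝ) ^ 2 * s.L n < c / C :=
    s.tendsto_sq_mul_L.eventually_lt_const (by positivity)
  filter_upwards [hsmall2, eventually_ge_atTop n₀] with m hm hmn₀ hdet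
  have hHm := s.one_le_H (m + 1)
  have hLm := s.L_pos m
  set δ : ℝ := (s.H (m + 1) : ℝ) ^ 2 * s.L m with hδ
  have hδ0 : 0 < δ := by positivity
  have hHL : s.H (m + 1) * s.L m ≤ δ := by
    rw [hδ, sq]
    refine mul_le_mul_of_nonneg_right ?_ hLm.le
    nlinarith
  have hδ1 : δ * (2 * D) < 1 := by
    have := hn₀ m hmn₀
    rwa [lt_div_iff₀ (by positivity)] at this
  have hCδ : C * δ < 1 := by nlinarith
  obtain ⟨hd1, hd2⟩ := s.cr_dev hζ.ne_zero (Nat.le_succ m)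
  simp only [Nat.succ_eq_add_one] at hd1 hd2
  have hCHL : 2 * s.H (m + 1) * s.L m * K ζ ≤ C * δ := by
    have := mul_le_mul_of_nonneg_left hHL (by positivity : 0 ≤ C)
    rw [hC] at this ⊢
    linarith
  set x := s.cr m (m + 1) with hx
  have hx0 : x 0 ≠ 0 := by
    intro h0
    have hx1 : x 1 = 0 := by
      unfold conic at hdet
      rw [h0] at hdet
      simpa using hdet
    have hx2 : x 2 = 0 := by
      rw [hx1] at hd2
      have h3 : |((x 2 : ℤ) : ℝ)| < 1 := by
        have := hd2.trans (hCHL.trans hCδ.le)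
        have h4 : |ζ * ((0 : ℤ) : ℝ) - (x 2 : ℝ)| = |(x 2 : ℝ)| := by simp
        rw [h4] at hd2
        linarith
      rw [← Int.cast_abs] at h3
      exact Int.abs_lt_one_iff.mp (by exact_mod_cast h3)
    exact s.cr_ne_zero (Nat.lt_succ_self m) (funext fun k => by fin_cases k <;> assumption)
  obtain ⟨u, v, g, hu, hco, hxu, hxv, hug, hux⟩ := exists_param_of_conic_eq_zero hdet hx0
  have hg : g ≠ 0 := by
    rintro rfl
    simp at hug
    exact hu hug
  have hhom : homEval (s.p m) u v = 0 :=
    homEval_eq_zero_of_dot hg hxu hxv hux (s.cr_dot_left m (m + 1))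
  have hudev : |(u : ℝ)| * |ζ * u - v| ≤ 2 * s.H (m + 1) * s.L m * K ζ := by
    refine le_trans ?_ hd1
    have h1 : ζ * (x 0 : ℝ) - x 1 = g * (ζ * u - v) := by
      rw [hxu, hxv]; push_cast; ring
    rw [h1, abs_mul]
    refine mul_le_mul_of_nonneg_right ?_ (abs_nonneg _)
    rw [← Int.cast_abs, ← Int.cast_abs]
    exact_mod_cast hug
  have hpne : ∀ n, s.p n ≠ 0 := by
    intro n h0
    exact s.eval_ne n (by simp [quadEval, h0])
  by_cases hn0 : homEval (s.p n₀) u v = 0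
  · have hule := abs_le_of_homEval_eq_zero hco (s.abs_le n₀) (hpne n₀) hu hn0
    have h1 := hcu u v hu hule
    have hu1 : (1 : ℝ) ≤ |(u : ℝ)| := by
      rw [← Int.cast_abs]; exact_mod_cast Int.one_le_abs hu
    rw [lt_div_iff₀ (by positivity)] at hm
    nlinarith [abs_nonneg (ζ * (u : ℝ) - v)]
  · have hex : ∃ i, n₀ ≤ i ∧ i < m ∧ homEval (s.p i) u v ≠ 0 ∧ homEval (s.p (i + 1)) u v = 0 := by
      by_contra! hcon
      have : ∀ k, n₀ ≤ k → k ≤ m → homEval (s.p k) u v ≠ 0 := by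
        intro k hk
        induction k, hk using Nat.le_induction with
        | base => exact fun _ => hn0
        | succ k hk ih => exact fun hkm => hcon k hk (by omega) (ih (by omega))
      exact this m hmn₀ le_rfl hhom
    obtain ⟨i, hi, him, hi0, hi1⟩ := hex
    have hule := abs_le_of_homEval_eq_zero hco (s.abs_le (i + 1)) (hpne _) hu hi1
    have h1 := one_le_of_homEval_ne_zero (s.abs_le i) (le_refl (s.L i)) hi0 hu hudev
      (hCHL.trans hCδ.le)
    have h2 : (u : ℝ) ^ 2 * s.L i ≤ (s.H (i + 1) : ℝ) ^ 2 * s.L i := by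
      refine mul_le_mul_of_nonneg_right ?_ (s.L_pos i).le
      rw [← sq_abs]
      exact pow_le_pow_left₀ (abs_nonneg _) hule 2
    have h3 : (s.H (i + 1) : ℝ) ^ 2 * s.L i * (2 * D) < 1 := by
      have := hn₀ i hi
      rwa [lt_div_iff₀ (by positivity)] at this
    have h4 : (s.H i : ℝ) * (2 * s.H (m + 1) * s.L m * K ζ) ≤ C * δ := by
      have h5 := mul_le_mul_of_nonneg_right (s.H_le (by omega : i ≤ m + 1))
        (by positivity : 0 ≤ C * (s.H (m + 1) * s.L m))
      rw [hC, hδ] at *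
      linarith
    have h6 := mul_le_mul_of_nonneg_right h4 (by positivity : 0 ≤ 2 + 2 * |ζ|)
    have h7 : 1 ≤ (s.H (i + 1) : ℝ) ^ 2 * s.L i + δ * (D - 1) := by
      rw [hD]
      linarith
    nlinarith

end ApproxSeq

lemma chain_bounds {e₀ f₀ e₁ f₁ e₂ f₂ e₃ f₃ h E σ : ℝ} (hσ : σ ^ 2 = 1 - σ) (h0 : 0 < σ)
    (hE : 0 ≤ E)
    (a₀ : e₀ ≤ σ * f₀ + E) (a₁ : e₁ ≤ σ * f₁ + E) (a₂ : e₂ ≤ σ * f₂ + E) (a₃ : e₃ ≤ σ * f₃ + E)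
    (b₁ : σ * f₁ ≤ e₁ + E) (b₂ : σ * f₂ ≤ e₂ + E) (b₃ : σ * f₃ ≤ e₃ + E)
    (c₀ : f₀ ≤ e₁) (c₁ : f₁ ≤ e₂) (c₂ : f₂ ≤ e₃) (c₃ : f₃ ≤ h)
    (d₀ : e₁ ≤ f₀ + 2 * E) (d₁ : e₂ ≤ f₁ + 2 * E) (d₂ : e₃ ≤ f₂ + 2 * E) (d₃ : h ≤ f₃ + 2 * E) :
    e₀ + f₀ + e₃ ≤ h + 10 * E ∧ 3 * h - 40 * E ≤ (σ + 1) * f₀ + (σ + 2) * f₃ := by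
  have hσE : σ * E ≤ E := by nlinarith
  have hσE0 : 0 ≤ σ * E := by positivity
  have m {x y : ℝ} (hxy : x ≤ y) : σ * x ≤ σ * y := mul_le_mul_of_nonneg_left hxy h0.le
  have sq (x : ℝ) : σ * (σ * x) = x - σ * x := by linear_combination x * hσ
  have u₃ : e₃ ≤ σ * h + E := by linarith [m c₃]
  have u₂ : e₂ ≤ h - σ * h + 2 * E := by
    have := m (c₂.trans u₃)
    rw [mul_add, sq] at this
    linarith
  have u₁ : e₁ ≤ 2 * (σ * h) - h + 3 * E := by
    have := m (c₁.trans u₂)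
    have e : σ * (h - σ * h + 2 * E) = 2 * (σ * h) - h + 2 * (σ * E) := by
      linear_combination (- h) * hσ
    linarith
  have w₀ : σ * f₀ ≤ 2 * h - 3 * (σ * h) + 3 * E := by
    have := m (c₀.trans u₁)
    have e : σ * (2 * (σ * h) - h + 3 * E) = 2 * h - 3 * (σ * h) + 3 * (σ * E) := by
      linear_combination 2 * h * hσ
    linarith
  have v₃ : σ * h - 3 * E ≤ e₃ := by linarith [m d₃]
  have v₂ : h - σ * h - 6 * E ≤ e₂ := by
    have := m (v₃.trans d₂)
    have e : σ * (σ * h - 3 * E) = h - σ * h - 3 * (σ * E) := by linear_combination h * hσ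
    linarith
  have v₁ : 2 * (σ * h) - h - 9 * E ≤ e₁ := by
    have := m (v₂.trans d₁)
    have e : σ * (h - σ * h - 6 * E) = 2 * (σ * h) - h - 6 * (σ * E) := by
      linear_combination (- h) * hσ
    linarith
  have v₀ : 2 * h - 3 * (σ * h) - 11 * E ≤ σ * f₀ := by
    have := m (v₁.trans d₀)
    have e : σ * (2 * (σ * h) - h - 9 * E) = 2 * h - 3 * (σ * h) - 9 * (σ * E) := by
      linear_combination 2 * h * hσ
    linarith
  constructor
  · linarith
  · have := m d₃
    linarith

lemma goldenRatio_gt : (8 / 5 : ℝ) < goldenRatio := by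
  have h5 : (11 / 5 : ℝ) < √5 := by
    rw [lt_sqrt (by norm_num)]; norm_num
  unfold goldenRatio
  linarith

namespace ApproxSeq

variable {ζ : ℝ} (s : ApproxSeq ζ)

lemma eventually_indep_le (hζ : ζ ≠ 0) {ε : ℝ} (hε : 0 < ε) :
    ∀ᶠ n in atTop, s.Indep n → goldenRatio * s.h (n + 1) ≤ s.h (n + 2) + ε * s.h (n + 2) := by
  have hC : 0 < 2 + 2 * K ζ * (2 + |ζ|) := by
    have := one_le_K ζ
    positivity
  filter_upwards [s.eventually_log_L_le (half_pos hε),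
    (tendsto_add_atTop_nat 2).eventually
      (s.eventually_le_mul_h (log (2 + 2 * K ζ * (2 + |ζ|))) (half_pos hε))] with n h1 h2 hn
  have h3 := log_four_nonneg hC (s.H_pos' _) (s.H_pos' _) (s.L_pos _) (s.one_le_of_indep hζ hn)
  have h4 := s.h_mono (show n + 1 ≤ n + 2 by omega)
  change 0 ≤ _ + s.h _ + s.h _ + _ at h3
  nlinarith

lemma eventually_coprime_le (hζ : Irrational ζ) {ε : ℝ} (hε : 0 < ε) :
    ∀ᶠ i in atTop, ∀ m, i ≤ m → (∀ l, i ≤ l → l < m → ¬ s.Indep l) →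
      goldenRatio * s.h (m + 1) ≤ s.h i + s.h (i + 1) + ε * s.h (m + 1) := by
  have hC : 0 < 8 * K ζ := by
    have := one_le_K ζ
    positivity
  obtain ⟨N, hN⟩ := eventually_atTop.mp (s.eventually_log_L_le (half_pos hε))
  filter_upwards [s.eventually_conic_ne_zero hζ, eventually_ge_atTop N,
    s.eventually_le_mul_h (log (8 * K ζ)) (half_pos hε)] with i h1 h2 h3 m him hJ
  have h4 := s.one_le_of_conic_ne_zero hζ.ne_zero h1
    (s.cr_dot_eq_zero (fun l hl hl' => hJ l hl (by omega)) him)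
    (s.cr_dot_eq_zero (fun l hl hl' => hJ l hl (by omega)) (by omega : i ≤ m + 1))
  have h5 := log_four_nonneg hC (mul_pos (s.H_pos' _) (s.H_pos' _)) (s.H_pos' _) (s.L_pos _) h4
  rw [log_mul (s.H_pos' _).ne' (s.H_pos' _).ne'] at h5
  change 0 ≤ _ + (s.h _ + s.h _) + s.h _ + _ at h5
  have h6 := hN m (h2.trans him)
  have h7 := s.h_mono (show i ≤ m + 1 by omega)
  nlinarith

lemma exists_indep (hζ : Irrational ζ) : ∀ N, ∃ l, N ≤ l ∧ s.Indep l := by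
  intro N
  obtain ⟨i, hi, hiN⟩ := ((s.eventually_coprime_le hζ (ε := 1 / 2) (by norm_num)).and
    (eventually_ge_atTop N)).exists
  by_contra! hcon
  obtain ⟨m, hm, him⟩ := (((tendsto_add_atTop_nat 1).eventually
    (s.tendsto_h.eventually_gt_atTop (s.h i + s.h (i + 1)))).and (eventually_ge_atTop i)).exists
  have h1 := hi m him fun l hl _ => hcon l (hiN.trans hl)
  have h2 := s.h_nonneg (m + 1)
  nlinarith [goldenRatio_gt]

/-- The relations between the heights at two consecutive independent places. -/
structure Step (ε : ℝ) (i j : ℕ) : Prop where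
  lt : i < j
  le_left : s.h i ≤ (goldenRatio - 1) * s.h (i + 1) + ε * s.h (i + 1)
  ge_left : (goldenRatio - 1) * s.h (i + 1) ≤ s.h i + ε * s.h (i + 1)
  le_right : s.h j ≤ s.h (i + 1) + 2 * ε * s.h j
  succ_ge : goldenRatio * s.h i ≤ (1 + ε) * s.h (i + 1)
  conic_succ : conic (s.cr i (i + 1)) ≠ 0
  conic_ne : conic (s.cr i j) ≠ 0

lemma exists_step (hζ : Irrational ζ) {ε : ℝ} (hε : 0 < ε) :
    ∃ N, ∀ l, N ≤ l → s.Indep l → ∃ l', l < l' ∧ s.Indep l' ∧ s.Step ε (l + 1) (l' + 1) := by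
  obtain ⟨N, hN⟩ := eventually_atTop.mp ((s.eventually_coprime_le hζ hε).and
    ((s.eventually_indep_le hζ.ne_zero hε).and (s.eventually_conic_ne_zero hζ)))
  refine ⟨N, fun l hl hIl => ?_⟩
  classical
  have hex := s.exists_indep hζ (l + 1)
  obtain ⟨l', ⟨hll', hI'⟩, hmin⟩ : ∃ l', (l + 1 ≤ l' ∧ s.Indep l') ∧
      ∀ k, k < l' → ¬ (l + 1 ≤ k ∧ s.Indep k) :=
    ⟨Nat.find hex, Nat.find_spec hex, fun k hk => Nat.find_min hex hk⟩
  have hno : ∀ k, l + 1 ≤ k → k < l' → ¬ s.Indep k := fun k hk hk' hI => hmin k hk' ⟨hk, hI⟩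
  have hφ := goldenRatio_gt
  have hφ2 := goldenRatio_sq
  have hφlt := goldenRatio_lt_two
  have hσ : (goldenRatio - 1) * goldenRatio = 1 := by linear_combination hφ2
  have A := (hN l hl).2.1 hIl
  have B := (hN (l + 1) (by omega)).1 (l + 1) le_rfl (fun k hk hk' => by omega)
  have C := (hN (l + 1) (by omega)).1 l' hll' hno
  have p1 := s.h_nonneg (l + 2)
  have p2 := s.h_nonneg (l' + 1)
  have p3 := s.h_mono (show l + 2 ≤ l' + 1 by omega)
  have hle : s.h (l + 1) ≤ (goldenRatio - 1) * s.h (l + 2) + ε * s.h (l + 2) := by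
    have h1 := mul_le_mul_of_nonneg_left A (by linarith : 0 ≤ goldenRatio - 1)
    rw [← mul_assoc, hσ, one_mul] at h1
    have h2 : (goldenRatio - 1) * (ε * s.h (l + 2)) ≤ 1 * (ε * s.h (l + 2)) :=
      mul_le_mul_of_nonneg_right (by linarith) (by positivity)
    linarith
  refine ⟨l', hll', hI', ?_, hle, ?_, ?_, ?_, ?_, ?_⟩
  · omega
  · linarith
  · have h2 : ε * s.h (l + 2) ≤ ε * s.h (l' + 1) := mul_le_mul_of_nonneg_left p3 hε.le
    have h1 : goldenRatio * s.h (l' + 1) ≤ goldenRatio * s.h (l + 2) + 2 * ε * s.h (l' + 1) := by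
      linarith
    have h3 := mul_le_mul_of_nonneg_left h1 (by linarith : 0 ≤ goldenRatio - 1)
    rw [mul_add, ← mul_assoc, ← mul_assoc, hσ, one_mul, one_mul] at h3
    have h4 : (goldenRatio - 1) * (2 * ε * s.h (l' + 1)) ≤ 1 * (2 * ε * s.h (l' + 1)) :=
      mul_le_mul_of_nonneg_right (by linarith) (by positivity)
    linarith
  · linarith
  · exact (hN (l + 1) (by omega)).2.2
  · obtain ⟨h01, h02, h12⟩ := s.cr_parallel (i := l + 1) (s.cr_dot_left _ _)
      (s.cr_dot_eq_zero (k := l' + 1) (fun k hk hk' => hno k hk (by omega)) (by omega))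
    exact conic_ne_zero_of_parallel (hN (l + 1) (by omega)).2.2
      (s.cr_ne_zero (by omega)) h01 h02 h12

/-- The coefficient matrix of `(y₁ - y₀ T) P`, `(y₂ - y₁ T) P`, `Q`, `T Q`. -/
def fourMatrix (y P Q : Fin 3 → ℤ) : Matrix (Fin 4) (Fin 4) ℤ :=
  !![y 1 * P 0, y 1 * P 1 - y 0 * P 0, y 1 * P 2 - y 0 * P 1, -(y 0 * P 2);
     y 2 * P 0, y 2 * P 1 - y 1 * P 0, y 2 * P 2 - y 1 * P 1, -(y 1 * P 2);
     Q 0, Q 1, Q 2, 0;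
     0, Q 0, Q 1, Q 2]

lemma det_fourMatrix (y P Q : Fin 3 → ℤ) :
    (fourMatrix y P Q).det = -(conic y * conic (P ⨯₃ Q)) := by
  unfold conic
  rw [cross_zero', cross_one', cross_two', Matrix.det_succ_row_zero]
  simp [fourMatrix, Fin.sum_univ_succ, Matrix.det_fin_three, Fin.succAbove, Matrix.submatrix]
  ring

end ApproxSeq

namespace ApproxSeq

variable {ζ : ℝ} (s : ApproxSeq ζ)

lemma exists_steps (hζ : Irrational ζ) {ε : ℝ} (hε : 0 < ε) (N : ℕ) :
    ∃ i₀ i₁ i₂ i₃ i₄ i₅, N ≤ i₀ ∧ s.Step ε i₀ i₁ ∧ s.Step ε i₁ i₂ ∧ s.Step ε i₂ i₃ ∧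
      s.Step ε i₃ i₄ ∧ s.Step ε i₄ i₅ := by
  obtain ⟨N', hN'⟩ := s.exists_step hζ hε
  obtain ⟨l₀, hl₀, I₀⟩ := s.exists_indep hζ (max N N')
  have hN := le_max_left N N'
  have hN2 := le_max_right N N'
  obtain ⟨l₁, h₁, I₁, S₁⟩ := hN' l₀ (by omega) I₀
  obtain ⟨l₂, h₂, I₂, S₂⟩ := hN' l₁ (by omega) I₁
  obtain ⟨l₃, h₃, I₃, S₃⟩ := hN' l₂ (by omega) I₂
  obtain ⟨l₄, h₄, I₄, S₄⟩ := hN' l₃ (by omega) I₃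
  obtain ⟨l₅, h₅, I₅, S₅⟩ := hN' l₄ (by omega) I₄
  exact ⟨_, _, _, _, _, _, by omega, S₁, S₂, S₃, S₄, S₅⟩

variable {s} in
lemma Step.mono_abs {ε E : ℝ} {i j : ℕ} (hS : s.Step ε i j) (hj : ε * s.h j ≤ E)
    (hε : 0 ≤ ε) :
    s.h i ≤ (goldenRatio - 1) * s.h (i + 1) + E ∧
    (goldenRatio - 1) * s.h (i + 1) ≤ s.h i + E ∧ s.h (i + 1) ≤ s.h j ∧
    s.h j ≤ s.h (i + 1) + 2 * E := by
  have h1 : s.h (i + 1) ≤ s.h j := s.h_mono hS.lt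
  have h2 : ε * s.h (i + 1) ≤ ε * s.h j := mul_le_mul_of_nonneg_left h1 hε
  have h3 := hS.le_left
  have h4 := hS.ge_left
  have h5 := hS.le_right
  exact ⟨by linarith, by linarith, h1, by linarith⟩

lemma abs_fourMatrix_le {a b c : ℝ} {y P Q : Fin 3 → ℤ} (hy : ∀ k, |(y k : ℝ)| ≤ a)
    (hP : ∀ k, |(P k : ℝ)| ≤ b) (hQ : ∀ k, |(Q k : ℝ)| ≤ c) {B : ℝ} (h1 : 2 * a * b ≤ B)
    (h2 : c ≤ B) (i k : Fin 4) : |(fourMatrix y P Q i k : ℝ)| ≤ B := by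
  have ha : 0 ≤ a := (abs_nonneg _).trans (hy 0)
  have hb : 0 ≤ b := (abs_nonneg _).trans (hP 0)
  have hB : 0 ≤ B := ((abs_nonneg _).trans (hQ 0)).trans h2
  have hab : 0 ≤ a * b := by positivity
  have m (i j : Fin 3) : |(y i : ℝ) * P j| ≤ a * b := by
    rw [abs_mul]; exact mul_le_mul (hy i) (hP j) (abs_nonneg _) ha
  have m1 (i j : Fin 3) : |(y i : ℝ) * P j| ≤ B := (m i j).trans (by linarith)
  have m2 (i j i' j' : Fin 3) : |(y i : ℝ) * P j - y i' * P j'| ≤ B := by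
    have := abs_sub ((y i : ℝ) * P j) (y i' * P j')
    linarith [m i j, m i' j']
  have q (i : Fin 3) : |(Q i : ℝ)| ≤ B := (hQ i).trans h2
  fin_cases i <;> fin_cases k <;> simp only [fourMatrix, Fin.zero_eta, Fin.mk_one,
    Fin.reduceFinMk, Matrix.of_apply, Matrix.cons_val', Matrix.cons_val_zero, Matrix.cons_val_one,
    Matrix.cons_val, Int.cast_mul, Int.cast_sub, Int.cast_neg, abs_neg, Int.cast_zero, abs_zero]
  all_goals first | exact m1 _ _ | exact m2 _ _ _ _ | exact q _ | exact hB

lemma abs_fourMatrix_eval_le {ζ d l m : ℝ} {y P Q : Fin 3 → ℤ} (h1 : |ζ * y 0 - y 1| ≤ d)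
    (h2 : |ζ * y 1 - y 2| ≤ d) (hP : |quadEval ζ P| ≤ l) (hQ : |quadEval ζ Q| ≤ m) {B : ℝ}
    (hB1 : d * l ≤ B) (hB2 : (1 + |ζ|) * m ≤ B) (i : Fin 4) :
    |∑ k : Fin 4, (fourMatrix y P Q i k : ℝ) * ζ ^ (k : ℕ)| ≤ B := by
  have hd : 0 ≤ d := (abs_nonneg _).trans h1
  have hm : 0 ≤ m := (abs_nonneg _).trans hQ
  have hz := abs_nonneg ζ
  have e0 : ∑ k : Fin 4, (fourMatrix y P Q 0 k : ℝ) * ζ ^ (k : ℕ) =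
      -((ζ * y 0 - y 1) * quadEval ζ P) := by
    simp [fourMatrix, Fin.sum_univ_four, quadEval]; ring
  have e1 : ∑ k : Fin 4, (fourMatrix y P Q 1 k : ℝ) * ζ ^ (k : ℕ) =
      -((ζ * y 1 - y 2) * quadEval ζ P) := by
    simp [fourMatrix, Fin.sum_univ_four, quadEval]; ring
  have e2 : ∑ k : Fin 4, (fourMatrix y P Q 2 k : ℝ) * ζ ^ (k : ℕ) = quadEval ζ Q := by
    simp [fourMatrix, Fin.sum_univ_four, quadEval]
  have e3 : ∑ k : Fin 4, (fourMatrix y P Q 3 k : ℝ) * ζ ^ (k : ℕ) = ζ * quadEval ζ Q := by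
    simp [fourMatrix, Fin.sum_univ_four, quadEval]; ring
  fin_cases i <;> simp only [Fin.zero_eta, Fin.mk_one, Fin.reduceFinMk]
  · rw [e0, abs_neg, abs_mul]
    exact (mul_le_mul h1 hP (abs_nonneg _) hd).trans hB1
  · rw [e1, abs_neg, abs_mul]
    exact (mul_le_mul h2 hP (abs_nonneg _) hd).trans hB1
  · rw [e2]
    nlinarith
  · rw [e3, abs_mul]
    nlinarith

/-- At arbitrarily large scales all four successive minima of the system of cubic polynomials
are as close to one as prescribed. -/
lemma exists_matrix {ζ : ℝ} (s : ApproxSeq ζ) (hζ : Irrational ζ) {ε : ℝ} (hε : 0 < ε) (Y₀ : ℝ) :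
    ∃ Y : ℝ, Y₀ ≤ Y ∧ ∃ M : Matrix (Fin 4) (Fin 4) ℤ, M.det ≠ 0 ∧
      (∀ i k, |(M i k : ℝ)| ≤ Y ^ (1 + ε)) ∧
      ∀ i, |∑ k : Fin 4, (M i k : ℝ) * ζ ^ (k : ℕ)| ≤ Y ^ (-3 + ε) := by
  obtain ⟨η, hη, hη1, hηε⟩ : ∃ η : ℝ, 0 < η ∧ η ≤ 1 / 10 ∧ 100 * η ≤ ε :=
    ⟨min (1 / 10) (ε / 100), by positivity, min_le_left _ _, by
      linarith [min_le_right (1 / 10) (ε / 100)]⟩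
  have hK := one_le_K ζ
  obtain ⟨N, hN⟩ := eventually_atTop.mp ((s.eventually_log_L_le hη).and
    ((s.tendsto_H.eventually_ge_atTop Y₀).and ((s.eventually_le_mul_h (log 4) hη).and
    ((s.eventually_le_mul_h (log (2 * K ζ)) hη).and
      (s.eventually_le_mul_h (log (1 + |ζ|)) hη)))))
  obtain ⟨i₀, i₁, i₂, i₃, i₄, i₅, hi₀, S₀, S₁, S₂, S₃, S₄⟩ := s.exists_steps hζ hη N
  have l₀ := S₀.lt
  have l₁ := S₁.lt
  have l₂ := S₂.lt
  have l₃ := S₃.lt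
  have bound {j : ℕ} (hj : j ≤ i₄) : η * s.h j ≤ η * s.h i₄ :=
    mul_le_mul_of_nonneg_left (s.h_mono hj) hη.le
  obtain ⟨a₀, b₀, c₀, d₀⟩ := S₀.mono_abs (bound (by omega)) hη.le
  obtain ⟨a₁, b₁, c₁, d₁⟩ := S₁.mono_abs (bound (by omega)) hη.le
  obtain ⟨a₂, b₂, c₂, d₂⟩ := S₂.mono_abs (bound (by omega)) hη.le
  obtain ⟨a₃, b₃, c₃, d₃⟩ := S₃.mono_abs (bound le_rfl) hη.le
  have hφ := goldenRatio_gt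
  have hφ2 := goldenRatio_sq
  have hφlt := goldenRatio_lt_two
  have hh := s.h_nonneg i₄
  have hE : 0 ≤ η * s.h i₄ := by positivity
  obtain ⟨t₁, t₂⟩ := chain_bounds (σ := goldenRatio - 1) (by linear_combination hφ2) (by linarith) hE a₀ a₁ a₂ a₃ b₁ b₂ b₃ c₀ c₁ c₂ c₃ d₀ d₁ d₂ d₃
  have n₄ := (hN i₄ (by omega)).2
  have hεh : 100 * (η * s.h i₄) ≤ ε * s.h i₄ := by
    rw [← mul_assoc]; exact mul_le_mul_of_nonneg_right hηε hh
  have hH4 := s.H_pos' i₄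
  refine ⟨s.H i₄, n₄.1, fourMatrix (s.cr i₀ (i₀ + 1)) (s.p i₃) (s.p i₄), ?_, ?_, ?_⟩
  · rw [det_fourMatrix]
    exact neg_ne_zero.mpr (mul_ne_zero S₀.conic_succ S₃.conic_ne)
  · refine abs_fourMatrix_le (s.abs_cr_le _ _) (s.abs_le _) (s.abs_le _) ?_ ?_
    · have p0 := s.H_pos' i₀
      have p1 := s.H_pos' (i₀ + 1)
      have p3 := s.H_pos' i₃
      have e : 2 * (2 * (s.H i₀ : ℝ) * s.H (i₀ + 1)) * s.H i₃ =
        4 * s.H i₀ * s.H (i₀ + 1) * s.H i₃ := by ring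
      rw [e, le_rpow_iff_log_le (by positivity) hH4, log_mul (by positivity) p3.ne',
        log_mul (by positivity) p1.ne', log_mul (by positivity) p0.ne']
      change _ + s.h _ + s.h _ + s.h _ ≤ _ * s.h _
      linarith [n₄.2.1]
    · rw [le_rpow_iff_log_le hH4 hH4]
      change s.h _ ≤ _ * s.h _
      linarith
  · obtain ⟨v₁, v₂⟩ := s.cr_dev hζ.ne_zero (Nat.le_succ i₀)
    refine abs_fourMatrix_eval_le v₁ v₂ (le_refl (s.L i₃)) (le_refl (s.L i₄)) ?_ ?_
    · have p1 := s.H_pos' (i₀ + 1)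
      have q0 := s.L_pos i₀
      have q3 := s.L_pos i₃
      have e : 2 * (s.H (i₀ + 1) : ℝ) * s.L i₀ * K ζ * s.L i₃ =
        2 * K ζ * s.H (i₀ + 1) * s.L i₀ * s.L i₃ := by ring
      rw [Nat.succ_eq_add_one, e, le_rpow_iff_log_le (by positivity) hH4,
        log_mul (by positivity) q3.ne', log_mul (by positivity) q0.ne',
        log_mul (by positivity) p1.ne']
      change _ + s.h _ + _ + _ ≤ _ * s.h _
      have r0 := (hN i₀ (by omega)).1
      have r3 := (hN i₃ (by omega)).1
      have w0 : η * s.h (i₀ + 1) ≤ η * s.h i₄ := bound (by omega)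
      have w3 : η * s.h (i₃ + 1) ≤ η * s.h i₄ := bound (by omega)
      linarith [n₄.2.2.1]
    · have q4 := s.L_pos i₄
      have hz : 0 < 1 + |ζ| := by positivity
      rw [le_rpow_iff_log_le (by positivity) hH4, log_mul hz.ne' q4.ne']
      change _ + _ ≤ _ * s.h _
      have r4 := (hN i₄ (by omega)).1
      have g4 := S₄.succ_ge
      have hp := s.h_nonneg (i₄ + 1)
      have x1 : 8 / 5 * s.h i₄ ≤ 11 / 10 * s.h (i₄ + 1) := by nlinarith
      have x2 : log (s.L i₄) ≤ - (5 / 2) * s.h (i₄ + 1) := by nlinarith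
      have x3 : η * s.h i₄ ≤ 1 / 10 * s.h i₄ := mul_le_mul_of_nonneg_right hη1 hh
      linarith [n₄.2.2.2]

end ApproxSeq

lemma abs_det_le {n : ℕ} {ζ ρ : ℝ} (M : Matrix (Fin (n + 1)) (Fin (n + 1)) ℤ)
    {b : Fin (n + 1) → ℝ} (hb : ∀ i k, |(M i k : ℝ)| ≤ b i)
    (hv : ∀ i, |∑ k, (M i k : ℝ) * ζ ^ (k : ℕ)| ≤ ρ * b i) :
    |(M.det : ℝ)| ≤ (n + 1).factorial * (ρ * ∏ i, b i) := by
  set A : Matrix (Fin (n + 1)) (Fin (n + 1)) ℝ := M.map (Int.castRingHom ℝ) with hA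
  have h1 : (M.det : ℝ) = A.det := by
    have := (Int.castRingHom ℝ).map_det M
    simpa [hA] using this
  have h2 := Matrix.det_updateCol_sum A 0 (fun k => ζ ^ (k : ℕ))
  simp only [Fin.coe_ofNat_eq_mod, Nat.zero_mod, pow_zero, one_smul] at h2
  rw [h1, ← h2, Matrix.det_apply]
  refine (Finset.abs_sum_le_sum_abs _ _).trans ?_
  have hterm : ∀ σ : Equiv.Perm (Fin (n + 1)),
      |Equiv.Perm.sign σ • ∏ i, A.updateCol 0 (fun k => ∑ i : Fin (n + 1), ζ ^ (i : ℕ) • A k i) (σ i) i| ≤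
        ρ * ∏ i, b i := by
    intro σ
    have hs : |Equiv.Perm.sign σ • ∏ i, A.updateCol 0 (fun k => ∑ i : Fin (n + 1), ζ ^ (i : ℕ) • A k i) (σ i) i|
        = |∏ i, A.updateCol 0 (fun k => ∑ i : Fin (n + 1), ζ ^ (i : ℕ) • A k i) (σ i) i| := by
      rcases Int.units_eq_one_or (Equiv.Perm.sign σ) with h | h <;> simp [h]
    rw [hs, Finset.abs_prod, ← Equiv.prod_comp σ b, Fin.prod_univ_succ, Fin.prod_univ_succ,
      ← mul_assoc]
    refine mul_le_mul ?_ (Finset.prod_le_prod (fun _ _ => abs_nonneg _) fun i _ => ?_)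
      (Finset.prod_nonneg fun _ _ => abs_nonneg _) ((abs_nonneg _).trans (hv _))
    · rw [Matrix.updateCol_self]
      simpa [hA, mul_comm] using hv (σ 0)
    · rw [Matrix.updateCol_ne (Fin.succ_ne_zero i)]
      simpa [hA] using hb (σ i.succ) i.succ
  refine (Finset.sum_le_card_nsmul _ _ _ fun σ _ => hterm σ).trans ?_
  rw [Finset.card_univ, Fintype.card_perm, Fintype.card_fin, nsmul_eq_mul]

lemma abs_coeff_le_polyH (P : ℤ[X]) (k : ℕ) : |(P.coeff k : ℝ)| ≤ polyH P := by
  by_cases h : k ∈ P.support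
  · have := Finset.le_sup (f := fun i => (P.coeff i).natAbs) h
    rw [polyH, ← Int.cast_abs, ← Nat.cast_natAbs]
    exact_mod_cast this
  · rw [notMem_support_iff.mp h, polyH]
    simp

lemma polyH_le {P : ℤ[X]} {X : ℝ} (hX : 0 ≤ X) (h : ∀ k, |(P.coeff k : ℝ)| ≤ X) :
    polyH P ≤ X := by
  rw [polyH]
  refine le_trans (Nat.cast_le.mpr (Finset.sup_le fun i _ => ?_)) (Nat.floor_le hX)
  rw [Nat.le_floor_iff hX, Nat.cast_natAbs, Int.cast_abs]
  exact h i

lemma pev_eq_sum {n : ℕ} {P : ℤ[X]} (hP : P.natDegree ≤ n) (ζ : ℝ) :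
    pev ζ P = ∑ k : Fin (n + 1), (P.coeff k : ℝ) * ζ ^ (k : ℕ) := by
  rw [pev, aeval_eq_sum_range' (Nat.lt_succ_of_le hP), Finset.sum_range]
  simp [zsmul_eq_mul]

/-- The integer polynomial with prescribed coefficients. -/
noncomputable def polyOfCoeffs {n : ℕ} (v : Fin (n + 1) → ℤ) : ℤ[X] :=
  ∑ k : Fin (n + 1), monomial (k : ℕ) (v k)

lemma coeff_polyOfCoeffs {n : ℕ} (v : Fin (n + 1) → ℤ) (k : Fin (n + 1)) :
    (polyOfCoeffs v).coeff k = v k := by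
  simp [polyOfCoeffs, coeff_monomial, Fin.val_inj]

lemma natDegree_polyOfCoeffs_le {n : ℕ} (v : Fin (n + 1) → ℤ) :
    (polyOfCoeffs v).natDegree ≤ n :=
  natDegree_sum_le_of_forall_le _ _ fun k _ =>
    (natDegree_monomial_le _).trans (Nat.lt_succ_iff.mp k.2)

lemma polyH_polyOfCoeffs_le {n : ℕ} {v : Fin (n + 1) → ℤ} {X : ℝ} (h : ∀ k, |(v k : ℝ)| ≤ X) :
    polyH (polyOfCoeffs v) ≤ X := by
  have hX : 0 ≤ X := (abs_nonneg _).trans (h 0)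
  refine polyH_le hX fun k => ?_
  by_cases hk : k < n + 1
  · have := coeff_polyOfCoeffs v ⟨k, hk⟩
    simp only at this
    rw [this]
    exact h _
  · rw [coeff_eq_zero_of_natDegree_lt ((natDegree_polyOfCoeffs_le v).trans_lt (by omega))]
    simpa using hX

lemma pev_polyOfCoeffs {n : ℕ} (v : Fin (n + 1) → ℤ) (ζ : ℝ) :
    pev ζ (polyOfCoeffs v) = ∑ k : Fin (n + 1), (v k : ℝ) * ζ ^ (k : ℕ) := by
  simp_rw [pev_eq_sum (natDegree_polyOfCoeffs_le v), coeff_polyOfCoeffs]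

lemma pev_ne_zero {ζ : ℝ} (hζ : Transcendental ℚ ζ) {P : ℤ[X]} (hP : P ≠ 0) : pev ζ P ≠ 0 := by
  have : Transcendental ℤ ζ := fun h => hζ (h.extendScalars Int.cast_injective)
  exact fun h => this ⟨P, hP, h⟩

lemma sum_mul_pow_ne_zero {n : ℕ} {ζ : ℝ} (hζ : Transcendental ℚ ζ) {v : Fin (n + 1) → ℤ}
    (hv : v ≠ 0) : ∑ k : Fin (n + 1), (v k : ℝ) * ζ ^ (k : ℕ) ≠ 0 := by
  rw [← pev_polyOfCoeffs]
  refine pev_ne_zero hζ fun h => hv (_root_.funext fun k => ?_)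
  rw [← coeff_polyOfCoeffs v k, h]
  simp

lemma exists_det_updateRow_ne_zero {n : ℕ} {M : Matrix (Fin n) (Fin n) ℤ} (hM : M.det ≠ 0)
    {b : Fin n → ℤ} (hb : b ≠ 0) : ∃ i, (M.updateRow i b).det ≠ 0 := by
  by_contra! h
  have h1 : Mᵀ.cramer b = 0 := by
    ext i
    rw [Matrix.cramer_transpose_apply, h i]
    rfl
  have h2 := Matrix.mulVec_cramer Mᵀ b
  rw [h1, Matrix.mulVec_zero, Matrix.det_transpose] at h2
  exact (smul_ne_zero hM hb) h2.symm

namespace ApproxSeq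

lemma le_three_of_mem_whSet {ζ : ℝ} (s : ApproxSeq ζ) (hζ : Irrational ζ) {η : ℝ} (hη : η ∈ whSet 3 ζ) : η ≤ 3 := by
  by_contra! h3
  obtain ⟨X₀, hX₀⟩ := hη
  have hη1 : 0 < η + 1 := by linarith
  set τ := 4 / (η + 1) with hτ
  have hτ0 : 0 < τ := by positivity
  have hτ1 : τ < 1 := by rw [hτ, div_lt_one hη1]; linarith
  have hτη : τ * η = 4 - τ := by rw [hτ]; field_simp; ring
  set ε := (1 - τ) / 6 with hε
  have hε0 : 0 < ε := by rw [hε]; linarith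
  obtain ⟨Y₀, hY₀⟩ := eventually_atTop.mp (((tendsto_rpow_atTop hτ0).eventually_ge_atTop X₀).and
    ((eventually_gt_atTop 0).and
      ((tendsto_rpow_atTop (by linarith : 0 < 3 * ε)).eventually_gt_atTop 24)))
  obtain ⟨Y, hY, M, hM, hM1, hM2⟩ := s.exists_matrix hζ hε0 Y₀
  obtain ⟨y1, y2, y3⟩ := hY₀ Y hY
  obtain ⟨P, hd, hH, hpos, hP⟩ := hX₀ _ y1
  have hb : (fun k : Fin 4 => P.coeff k) ≠ 0 := by
    intro h
    rw [pev_eq_sum hd] at hpos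
    have : ∀ k : Fin 4, P.coeff k = 0 := fun k => congrFun h k
    simp [this] at hpos
  obtain ⟨i, hi⟩ := exists_det_updateRow_ne_zero hM hb
  have hdet := abs_det_le (ζ := ζ) (ρ := Y ^ (-4 : ℝ)) (M.updateRow i fun k => P.coeff k)
    (b := Function.update (fun _ => Y ^ (1 + ε)) i (Y ^ τ)) (fun j k => ?_) (fun j => ?_)
  · rw [Finset.prod_update_of_mem (Finset.mem_univ i), Finset.prod_const,
      Finset.card_sdiff_of_subset (by simp)] at hdet
    have h1 : (1 : ℝ) ≤ |((M.updateRow i fun k : Fin 4 => P.coeff k).det : ℝ)| := by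
      rw [← Int.cast_abs]; exact_mod_cast Int.one_le_abs hi
    have h2 : Y ^ (-4 : ℝ) * (Y ^ τ * (Y ^ (1 + ε)) ^ (3 : ℕ)) = (Y ^ (3 * ε))⁻¹ := by
      rw [← rpow_mul_natCast y2.le, ← rpow_add y2, ← rpow_add y2, ← rpow_neg y2.le]
      congr 1
      rw [hε]
      push_cast
      ring
    simp only [Finset.card_univ, Fintype.card_fin, Finset.card_singleton] at hdet
    rw [h2] at hdet
    have h4 := h1.trans hdet
    rw [← div_eq_mul_inv, le_div_iff₀ (by linarith)] at h4
    norm_num [Nat.factorial] at h4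
    linarith
  · by_cases hj : j = i
    · subst hj
      simpa using (abs_coeff_le_polyH P k).trans hH
    · simpa [hj] using hM1 j k
  · by_cases hj : j = i
    · subst hj
      rw [pev_eq_sum hd, ← rpow_mul y2.le] at hP
      simp only [Matrix.updateRow_self, Function.update_self]
      rw [← rpow_add y2]
      convert hP using 2
      linarith
    · simp only [Matrix.updateRow_ne hj, Function.update_of_ne hj]
      rw [← rpow_add y2]
      convert hM2 j using 2
      ring

lemma le_third_of_mem_lamhSet {ζ : ℝ} (s : ApproxSeq ζ) (hζ : Irrational ζ) {η : ℝ} (hη : η ∈ lamhSet 3 ζ) :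
    η ≤ 1 / 3 := by
  by_contra! h3
  obtain ⟨X₀, hX₀⟩ := hη
  obtain ⟨ε, hε0, hε1, hε2⟩ : ∃ ε : ℝ, 0 < ε ∧ ε ≤ 1 / 2 ∧ ε * (1 + 2 * η) < 3 * η - 1 := by
    have : 0 < (3 * η - 1) / (1 + 2 * η) := div_pos (by linarith) (by linarith)
    refine ⟨min (1 / 2) ((3 * η - 1) / (1 + 2 * η) / 2), by positivity, min_le_left _ _, ?_⟩
    have h := min_le_right (1 / 2) ((3 * η - 1) / (1 + 2 * η) / 2)
    have := mul_le_mul_of_nonneg_right h (by linarith : 0 ≤ 1 + 2 * η)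
    have e : (3 * η - 1) / (1 + 2 * η) / 2 * (1 + 2 * η) = (3 * η - 1) / 2 := by
      have : 1 + 2 * η ≠ 0 := by linarith
      field_simp
    linarith
  set δ := 3 * η - 1 - ε * (1 + 2 * η) with hδ
  have hδ0 : 0 < δ := by rw [hδ]; linarith
  obtain ⟨Y₀, hY₀⟩ := eventually_atTop.mp
    (((tendsto_rpow_atTop (by linarith : 0 < 3 - 2 * ε)).eventually_ge_atTop X₀).and
    ((eventually_gt_atTop 0).and (((tendsto_rpow_atTop hε0).eventually_gt_atTop 2).and
      ((tendsto_rpow_atTop hδ0).eventually_gt_atTop 6))))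
  obtain ⟨Y, hY, M, hM, hM1, hM2⟩ := s.exists_matrix hζ hε0 Y₀
  obtain ⟨y1, y2, y3, y4⟩ := hY₀ Y hY
  obtain ⟨x, y, hxy, hx, hy⟩ := hX₀ _ y1
  have hv : (Fin.cons x y : Fin 4 → ℤ) ≠ 0 := by
    intro h
    rcases hxy with h' | h'
    · exact h' (congrFun h 0)
    · exact h' (_root_.funext fun i => congrFun h i.succ)
  refine hv (Matrix.eq_zero_of_mulVec_eq_zero hM (_root_.funext fun i => ?_))
  have hA : |∑ k : Fin 4, (M i k : ℝ) * ζ ^ (k : ℕ)| * |(x : ℝ)| < 1 / 2 := by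
    rw [Int.cast_abs] at hx
    refine (mul_le_mul (hM2 i) hx (abs_nonneg _) (by positivity)).trans_lt ?_
    rw [← rpow_add y2, show -3 + ε + (3 - 2 * ε) = -ε by ring, rpow_neg y2.le, inv_lt_comm₀
      (by linarith) (by norm_num)]
    linarith
  have hB (k : Fin 3) : |(M i k.succ : ℝ)| * |ζ ^ ((k : ℕ) + 1) * (x : ℝ) - (y k : ℝ)| < 1 / 6 := by
    refine (mul_le_mul (hM1 i _) (hy k) (abs_nonneg _) (by positivity)).trans_lt ?_
    rw [← rpow_mul y2.le, ← rpow_add y2, show 1 + ε + (3 - 2 * ε) * -η = -δ by rw [hδ]; ring,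
      rpow_neg y2.le, inv_lt_comm₀ (by linarith) (by norm_num)]
    linarith
  have key : ((∑ k : Fin 4, M i k * (Fin.cons x y : Fin 4 → ℤ) k : ℤ) : ℝ) =
      (∑ k : Fin 4, (M i k : ℝ) * ζ ^ (k : ℕ)) * x -
        ∑ k : Fin 3, (M i k.succ : ℝ) * (ζ ^ ((k : ℕ) + 1) * (x : ℝ) - (y k : ℝ)) := by
    simp only [Fin.sum_univ_succ (n := 3), Fin.cons_zero, Fin.cons_succ, Fin.val_succ,
      Fin.val_zero, pow_zero, mul_one, mul_sub, Finset.sum_sub_distrib, add_mul, Finset.sum_mul]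
    push_cast
    simp only [mul_assoc]
    ring
  have h1 : |((∑ k : Fin 4, M i k * (Fin.cons x y : Fin 4 → ℤ) k : ℤ) : ℝ)| < 1 := by
    rw [key]
    refine (abs_sub _ _).trans_lt ?_
    rw [abs_mul, Fin.sum_univ_three]
    refine (add_le_add_right (abs_add_three _ _ _) _).trans_lt ?_
    simp only [abs_mul (M i _ : ℝ)]
    linarith [hB 0, hB 1, hB 2]
  rw [← Int.cast_abs] at h1
  have h2 : |∑ k : Fin 4, M i k * (Fin.cons x y : Fin 4 → ℤ) k| < 1 := by exact_mod_cast h1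
  exact Int.abs_lt_one_iff.mp h2

end ApproxSeq

lemma exists_small_cubic {ζ : ℝ} {N : ℕ} (hN : 0 < N) :
    ∃ v : Fin 4 → ℤ, v ≠ 0 ∧ (∀ k, |(v k : ℝ)| ≤ N) ∧
      |∑ k : Fin 4, (v k : ℝ) * ζ ^ (k : ℕ)| ≤
        2 * (∑ k : Fin 4, |ζ| ^ (k : ℕ)) / (N : ℝ) ^ 3 := by
  set C := ∑ k : Fin 4, |ζ| ^ (k : ℕ) with hC
  have hC0 : 0 < C := by
    rw [hC, Fin.sum_univ_succ, Fin.val_zero, pow_zero]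
    positivity
  have hN' : (0 : ℝ) < N := by exact_mod_cast hN
  set w := 2 * C / (N : ℝ) ^ 3 with hw
  have hw0 : 0 < w := by positivity
  let g (u : Fin 4 → Fin (N + 1)) : ℝ := ∑ k, ((u k : ℕ) : ℝ) * ζ ^ (k : ℕ)
  have hg (u) : |g u| ≤ C * N := by
    rw [hC, Finset.sum_mul]
    refine (Finset.abs_sum_le_sum_abs _ _).trans (Finset.sum_le_sum fun k _ => ?_)
    rw [abs_mul, abs_pow, Nat.abs_cast, mul_comm]
    exact mul_le_mul_of_nonneg_left (by exact_mod_cast Nat.lt_succ_iff.mp (u k).2) (by positivity)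
  have h0 (u) : 0 ≤ (g u + C * N) / w := div_nonneg (by linarith [neg_le_of_abs_le (hg u)]) hw0.le
  obtain ⟨u, -, u', -, hne, heq⟩ := Finset.exists_ne_map_eq_of_card_lt_of_maps_to
    (s := Finset.univ) (t := Finset.range (N ^ 4 + 1)) (f := fun u => ⌊(g u + C * N) / w⌋₊)
    (by
      rw [Finset.card_range, Finset.card_univ, Fintype.card_fun, Fintype.card_fin,
        Fintype.card_fin]
      ring_nf
      nlinarith)
    (fun u _ => by
      rw [Finset.mem_coe, Finset.mem_range, Nat.lt_succ_iff]
      refine Nat.floor_le_of_le ?_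
      rw [div_le_iff₀ hw0, hw]
      push_cast
      have : (N : ℝ) ^ 4 * (2 * C / (N : ℝ) ^ 3) = 2 * (C * N) := by field_simp
      rw [this]
      linarith [le_of_abs_le (hg u)])
  refine ⟨fun k => ((u k : ℕ) : ℤ) - ((u' k : ℕ) : ℤ), ?_, fun k => ?_, ?_⟩
  · contrapose! hne
    refine _root_.funext fun k => Fin.ext ?_
    have := congrFun hne k
    simp only [Pi.zero_apply] at this
    omega
  · rw [abs_le]
    have h1 : ((u k : ℕ) : ℝ) ≤ N := by exact_mod_cast Nat.lt_succ_iff.mp (u k).2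
    have h2 : ((u' k : ℕ) : ℝ) ≤ N := by exact_mod_cast Nat.lt_succ_iff.mp (u' k).2
    have h3 : (0 : ℝ) ≤ ((u k : ℕ) : ℝ) := Nat.cast_nonneg _
    have h4 : (0 : ℝ) ≤ ((u' k : ℕ) : ℝ) := Nat.cast_nonneg _
    push_cast
    constructor <;> linarith
  · have e : ∑ k : Fin 4, ((((u k : ℕ) : ℤ) - ((u' k : ℕ) : ℤ) : ℤ) : ℝ) * ζ ^ (k : ℕ) =
        ((g u + C * N) / w - (g u' + C * N) / w) * w := by
      rw [← sub_div, div_mul_cancel₀ _ hw0.ne', add_sub_add_right_eq_sub]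
      simp only [g, ← Finset.sum_sub_distrib]
      push_cast
      simp only [sub_mul]
    rw [e, abs_mul, abs_of_pos hw0]
    refine mul_le_of_le_one_left hw0.le ?_
    have a1 := Nat.floor_le (h0 u)
    have a2 := Nat.floor_le (h0 u')
    have b1 := Nat.lt_floor_add_one ((g u + C * N) / w)
    have b2 := Nat.lt_floor_add_one ((g u' + C * N) / w)
    rw [heq] at a1 b1
    rw [abs_le]
    constructor <;> linarith

lemma exists_simultaneous {n : ℕ} (ξ : Fin n → ℝ) {K : ℕ} (hK : 0 < K) :
    ∃ x : ℤ, ∃ y : Fin n → ℤ, x ≠ 0 ∧ |x| ≤ (K : ℤ) ^ n ∧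
      ∀ i, |ξ i * x - y i| ≤ (K : ℝ)⁻¹ := by
  have hK' : (0 : ℝ) < K := by exact_mod_cast hK
  have hlt (x : ℕ) (i) : ⌊Int.fract (ξ i * x) * K⌋₊ < K := by
    rw [Nat.floor_lt (mul_nonneg (Int.fract_nonneg _) hK'.le)]
    exact mul_lt_of_lt_one_left hK' (Int.fract_lt_one _)
  obtain ⟨a, ha, b, hb, hne, heq⟩ := Finset.exists_ne_map_eq_of_card_lt_of_maps_to
    (s := Finset.range (K ^ n + 1)) (t := (Finset.univ : Finset (Fin n → Fin K)))
    (f := fun x i => ⟨⌊Int.fract (ξ i * x) * K⌋₊, hlt x i⟩) (by simp) (fun _ _ => by simp)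
  rw [Finset.mem_range, Nat.lt_succ_iff] at ha hb
  refine ⟨(a : ℤ) - b, fun i => ⌊ξ i * a⌋ - ⌊ξ i * b⌋, ?_, ?_, fun i => ?_⟩
  · omega
  · have ha' : (a : ℤ) ≤ (K : ℤ) ^ n := by exact_mod_cast ha
    have hb' : (b : ℤ) ≤ (K : ℤ) ^ n := by exact_mod_cast hb
    rw [abs_le]
    constructor <;> omega
  · have hi := congrArg Fin.val (congrFun heq i)
    simp only at hi
    have a1 := Nat.floor_le (mul_nonneg (Int.fract_nonneg (ξ i * a)) hK'.le)
    have a2 := Nat.floor_le (mul_nonneg (Int.fract_nonneg (ξ i * b)) hK'.le)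
    have b1 := Nat.lt_floor_add_one (Int.fract (ξ i * a) * K)
    have b2 := Nat.lt_floor_add_one (Int.fract (ξ i * b) * K)
    rw [hi] at a1 b1
    have e : ξ i * (((a : ℤ) - b : ℤ) : ℝ) - ((⌊ξ i * a⌋ - ⌊ξ i * b⌋ : ℤ) : ℝ) =
        Int.fract (ξ i * a) - Int.fract (ξ i * b) := by
      simp only [Int.fract]
      push_cast
      ring
    rw [e, ← one_div, le_div_iff₀ hK', ← abs_of_pos hK', ← abs_mul, sub_mul,
      abs_le]
    constructor <;> linarith

lemma mem_whSet_of_lt_three {ζ : ℝ} (hζ : Transcendental ℚ ζ) {η : ℝ} (hη : η < 3) :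
    η ∈ whSet 3 ζ := by
  set C := ∑ k : Fin 4, |ζ| ^ (k : ℕ) with hC
  have hC0 : 0 ≤ C := Finset.sum_nonneg fun _ _ => by positivity
  obtain ⟨X₀, hX₀⟩ := eventually_atTop.mp ((eventually_ge_atTop (1 : ℝ)).and
    ((tendsto_rpow_atTop (by linarith : 0 < 3 - η)).eventually_ge_atTop (16 * C)))
  refine ⟨X₀, fun X hX => ?_⟩
  obtain ⟨x1, x2⟩ := hX₀ X hX
  have hX0 : 0 < X := by linarith
  obtain ⟨v, hv, hvN, hvζ⟩ := exists_small_cubic (ζ := ζ) (Nat.floor_pos.mpr x1)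
  refine ⟨polyOfCoeffs v, natDegree_polyOfCoeffs_le v,
    polyH_polyOfCoeffs_le fun k => (hvN k).trans (Nat.floor_le hX0.le), ?_, ?_⟩
  · rw [pev_polyOfCoeffs, abs_pos]
    exact sum_mul_pow_ne_zero hζ hv
  · rw [pev_polyOfCoeffs]
    refine hvζ.trans ?_
    have hfl : X / 2 ≤ ⌊X⌋₊ := by
      have h1 := Nat.lt_floor_add_one X
      have h2 : (1 : ℝ) ≤ ⌊X⌋₊ := by exact_mod_cast Nat.floor_pos.mpr x1
      linarith
    calc 2 * C / (⌊X⌋₊ : ℝ) ^ 3 ≤ 2 * C / (X / 2) ^ 3 := by gcongr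
      _ = 16 * C / X ^ 3 := by ring
      _ ≤ X ^ (3 - η) / X ^ 3 := by gcongr
      _ = X ^ (-η) := by
        rw [← rpow_natCast X 3, ← rpow_sub hX0]
        congr 1
        push_cast
        ring

lemma mem_lamhSet_of_lt_third {ζ η : ℝ} (hη : η < 1 / 3) : η ∈ lamhSet 3 ζ := by
  obtain ⟨X₀, hX₀⟩ := eventually_atTop.mp ((eventually_ge_atTop (1 : ℝ)).and
    ((tendsto_rpow_atTop (by linarith : 0 < 1 / 3 - η)).eventually_ge_atTop 2))
  refine ⟨X₀, fun X hX => ?_⟩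
  obtain ⟨x1, x2⟩ := hX₀ X hX
  have hX0 : 0 < X := by linarith
  have hr : 1 ≤ X ^ (1 / 3 : ℝ) := one_le_rpow x1 (by norm_num)
  have hK := Nat.floor_pos.mpr hr
  obtain ⟨x, y, hx, hxK, hxy⟩ := exists_simultaneous (fun i : Fin 3 => ζ ^ ((i : ℕ) + 1)) hK
  refine ⟨x, y, Or.inl hx, ?_, fun i => (hxy i).trans ?_⟩
  · have h1 : ((|x| : ℤ) : ℝ) ≤ (⌊X ^ (1 / 3 : ℝ)⌋₊ : ℝ) ^ 3 := by exact_mod_cast hxK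
    refine h1.trans ((pow_le_pow_left₀ (Nat.cast_nonneg _) (Nat.floor_le (by linarith)) 3).trans ?_)
    rw [← rpow_mul_natCast hX0.le]
    norm_num
  · have hfl : X ^ (1 / 3 : ℝ) / 2 ≤ ⌊X ^ (1 / 3 : ℝ)⌋₊ := by
      have h1 := Nat.lt_floor_add_one (X ^ (1 / 3 : ℝ))
      have h2 : (1 : ℝ) ≤ ⌊X ^ (1 / 3 : ℝ)⌋₊ := by exact_mod_cast hK
      linarith
    calc (⌊X ^ (1 / 3 : ℝ)⌋₊ : ℝ)⁻¹ ≤ (X ^ (1 / 3 : ℝ) / 2)⁻¹ := by gcongr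
      _ = 2 / X ^ (1 / 3 : ℝ) := by rw [inv_div]
      _ ≤ X ^ (1 / 3 - η) / X ^ (1 / 3 : ℝ) := by gcongr
      _ = X ^ (-η) := by
        rw [← rpow_sub hX0]
        congr 1
        ring

lemma csSup_eq_of_forall {S : Set ℝ} {a : ℝ} (h1 : ∀ x ∈ S, x ≤ a) (h2 : ∀ x < a, x ∈ S) :
    sSup S = a :=
  csSup_eq_of_forall_le_of_forall_lt_exists_gt ⟨a - 1, h2 _ (by linarith)⟩ h1 fun w hw =>
    ⟨(w + a) / 2, h2 _ (by linarith), by linarith⟩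

lemma quadEval_eq_sum (ζ : ℝ) (v : Fin 3 → ℤ) :
    quadEval ζ v = ∑ k : Fin 3, (v k : ℝ) * ζ ^ (k : ℕ) := by
  simp [quadEval, Fin.sum_univ_three]

lemma quadEval_ne_zero {ζ : ℝ} (hζ : Transcendental ℚ ζ) {v : Fin 3 → ℤ} (hv : v ≠ 0) :
    quadEval ζ v ≠ 0 := by
  rw [quadEval_eq_sum]
  exact sum_mul_pow_ne_zero hζ hv

lemma goldenRatio_add_one : goldenRatio + 1 = (3 + √5) / 2 := by
  rw [goldenRatio]
  ring

lemma IsExtremal.exists_quadEval_le {ζ : ℝ} (hζ : IsExtremal ζ) {θ : ℝ}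
    (hθ : θ < goldenRatio + 1) :
    ∃ X₀ : ℝ, ∀ X, X₀ ≤ X → ∃ v : Fin 3 → ℤ, v ≠ 0 ∧ (∀ k, |(v k : ℝ)| ≤ X) ∧
      |quadEval ζ v| ≤ X ^ (-θ) := by
  have hs : sSup (whSet 2 ζ) = goldenRatio + 1 := by
    rw [goldenRatio_add_one]
    exact hζ.2
  have hne : (whSet 2 ζ).Nonempty := by
    by_contra! h
    rw [h, Real.sSup_empty] at hs
    linarith [goldenRatio_pos]
  obtain ⟨η, ⟨X₀, hX₀⟩, hη⟩ := exists_lt_of_lt_csSup hne (hs.symm ▸ hθ)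
  refine ⟨max X₀ 1, fun X hX => ?_⟩
  obtain ⟨P, hd, hH, hpos, hP⟩ := hX₀ X ((le_max_left _ _).trans hX)
  have e : quadEval ζ (fun k : Fin 3 => P.coeff k) = pev ζ P := by
    rw [pev_eq_sum hd, quadEval_eq_sum]
  refine ⟨fun k => P.coeff k, fun h => ?_, fun k => (abs_coeff_le_polyH P k).trans hH, ?_⟩
  · rw [← e, h] at hpos
    simp [quadEval] at hpos
  · rw [e]
    exact hP.trans (rpow_le_rpow_of_exponent_le ((le_max_right _ _).trans hX) (by linarith))

lemma exists_minimal_quadEval (ζ : ℝ) (n : ℕ) :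
    ∃ v : Fin 3 → ℤ, v ≠ 0 ∧ (∀ k, |v k| ≤ n + 1) ∧
      ∀ w : Fin 3 → ℤ, w ≠ 0 → (∀ k, |w k| ≤ n + 1) → |quadEval ζ v| ≤ |quadEval ζ w| := by
  have hfin : {v : Fin 3 → ℤ | v ≠ 0 ∧ ∀ k, |v k| ≤ n + 1}.Finite := by
    refine (Set.finite_Icc (fun _ => -(n + 1 : ℤ)) (fun _ => (n + 1 : ℤ))).subset ?_
    rintro v ⟨-, hv⟩
    exact ⟨fun k => (abs_le.mp (hv k)).1, fun k => (abs_le.mp (hv k)).2⟩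
  obtain ⟨v, hv, hmin⟩ := Set.exists_min_image _ (fun v => |quadEval ζ v|) hfin
    ⟨1, one_ne_zero, fun k => by simp⟩
  exact ⟨v, hv.1, hv.2, fun w h1 h2 => hmin w ⟨h1, h2⟩⟩

/-- The minimal points of an extremal number form an approximation sequence. -/
lemma IsExtremal.nonempty_approxSeq {ζ : ℝ} (hζ : IsExtremal ζ) : Nonempty (ApproxSeq ζ) := by
  choose q q_ne q_le q_min using exists_minimal_quadEval ζ
  set m : ℕ → ℝ := fun n => |quadEval ζ (q n)| with hm
  have m_pos (n) : 0 < m n := abs_pos.mpr (quadEval_ne_zero hζ.1 (q_ne n))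
  have m_anti : Antitone m := antitone_nat_of_succ_le fun n => q_min _ _ (q_ne n) fun k => by
    have := q_le n k
    push_cast
    linarith
  have m_small (j) : ∃ i, m i < m j := by
    obtain ⟨X₀, hX₀⟩ := hζ.exists_quadEval_le (θ := 1) (by linarith [goldenRatio_pos])
    obtain ⟨n, hn⟩ := exists_nat_gt (max X₀ (m j)⁻¹)
    have hn0 : (0 : ℝ) < n := ((inv_pos.mpr (m_pos j)).trans_le (le_max_right _ _)).trans hn
    obtain ⟨v, hv, hvn, hvζ⟩ := hX₀ n ((le_max_left _ _).trans hn.le)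
    refine ⟨n, (q_min n v hv fun k => ?_).trans_lt (hvζ.trans_lt ?_)⟩
    · have := hvn k
      rw [← Int.cast_abs] at this
      have : |v k| ≤ n := by exact_mod_cast this
      linarith
    · rw [rpow_neg_one]
      exact inv_lt_of_inv_lt₀ (m_pos j) ((le_max_right _ _).trans_lt hn)
  have m_next (j) : ∃ i, m i < m j ∧ ∀ l, m l < m j → i ≤ l := by
    classical
    exact ⟨Nat.find (m_small j), Nat.find_spec (m_small j), fun l hl => Nat.find_min' _ hl⟩
  choose f f_lt f_min using m_next
  set G : ℕ → ℕ := fun n => f^[n] 0 with hG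
  have G_succ (n) : G (n + 1) = f (G n) := Function.iterate_succ_apply' f n 0
  have G_mono : StrictMono G := strictMono_nat_of_lt_succ fun n => by
    rw [G_succ]
    by_contra! h
    exact (m_anti h).not_gt (f_lt _)
  refine ⟨⟨fun n => q (G n), fun n => G n + 1, fun n => Nat.succ_pos _,
    fun i j h => Nat.succ_lt_succ (G_mono h), fun n k => ?_, fun n => ?_,
    fun n => quadEval_ne_zero hζ.1 (q_ne _), fun i j h => m_anti (G_mono.monotone h),
    fun θ hθ => ?_⟩⟩
  · rw [← Int.cast_abs]
    exact_mod_cast q_le (G n) k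
  · by_contra! h
    have h' (k) : |q (G n) k| < (G n + 1 : ℤ) := by
      have := h k
      rw [← Int.cast_abs] at this
      exact_mod_cast this
    rcases n with - | n
    · refine q_ne (G 0) (_root_.funext fun k => Int.abs_lt_one_iff.mp ?_)
      simpa [hG] using h' k
    · have hpos : 0 < G (n + 1) := (Nat.zero_le _).trans_lt (G_mono (Nat.succ_pos n))
      obtain ⟨l, hl⟩ : ∃ l, G (n + 1) = l + 1 := ⟨G (n + 1) - 1, by omega⟩
      have h1 : m l ≤ m (G (n + 1)) := q_min l _ (q_ne _) fun k => by
        have := h' k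
        rw [hl] at this ⊢
        push_cast at this
        linarith
      have h2 := f_min (G n) l (h1.trans_lt (by rw [G_succ]; exact f_lt _))
      rw [← G_succ] at h2
      omega
  · obtain ⟨θ', h1, h2⟩ := exists_between (max_lt hθ (by linarith [goldenRatio_pos] :
      0 < goldenRatio + 1))
    have hθ' := (le_max_left _ _).trans_lt h1
    have hθ0 := (le_max_right _ _).trans_lt h1
    obtain ⟨X₀, hX₀⟩ := hζ.exists_quadEval_le h2
    have hT : Tendsto (fun n => ((G (n + 1) + 1 : ℕ) : ℝ)) atTop atTop :=
      tendsto_natCast_atTop_atTop.comp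
        ((tendsto_add_atTop_nat 1).comp (G_mono.tendsto_atTop.comp (tendsto_add_atTop_nat 1)))
    filter_upwards [hT.eventually_ge_atTop (X₀ + 1 / 2), ((tendsto_rpow_atTop
      (by linarith : 0 < θ' - θ)).comp hT).eventually_ge_atTop ((2 : ℝ) ^ θ')] with n n1 n2
    simp only [Function.comp_apply] at n2
    set Z : ℝ := ((G (n + 1) + 1 : ℕ) : ℝ) with hZ
    have hZ1 : 1 ≤ Z := by rw [hZ]; exact_mod_cast Nat.succ_pos _
    have hZ0 : 0 < Z := by linarith
    have hpos : 0 < G (n + 1) := (Nat.zero_le _).trans_lt (G_mono (Nat.succ_pos n))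
    obtain ⟨l, hl⟩ : ∃ l, G (n + 1) = l + 1 := ⟨G (n + 1) - 1, by omega⟩
    have hml : m (G n) ≤ m l := by
      by_contra! h
      have := f_min _ _ h
      rw [← G_succ] at this
      omega
    obtain ⟨v, hv, hvX, hvζ⟩ := hX₀ (Z - 1 / 2) (by linarith)
    have hmv : m l ≤ |quadEval ζ v| := q_min l v hv fun k => by
      have h3 := hvX k
      rw [← Int.cast_abs, hZ, hl] at h3
      have h4 : ((|v k| : ℤ) : ℝ) < ((l + 2 : ℤ) : ℝ) := by
        push_cast at h3 ⊢
        linarith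
      have h5 : |v k| < (l + 2 : ℤ) := by exact_mod_cast h4
      linarith
    calc m (G n) ≤ (Z - 1 / 2) ^ (-θ') := (hml.trans hmv).trans hvζ
      _ ≤ (Z / 2) ^ (-θ') :=
        rpow_le_rpow_of_nonpos (by positivity) (by linarith) (by linarith)
      _ = 2 ^ θ' / Z ^ θ' := by
        rw [rpow_neg (by positivity), div_rpow hZ0.le (by norm_num), inv_div]
      _ ≤ Z ^ (θ' - θ) / Z ^ θ' := by gcongr
      _ = Z ^ (-θ) := by
        rw [← rpow_sub hZ0]
        congr 1
        ring

theorem extremal_wh3_lamh3 (ζ : ℝ) (hζ : IsExtremal ζ) :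
    whExp 3 ζ = 3 ∧ lamhExp 3 ζ = 1 / 3 := by
  obtain ⟨s⟩ := hζ.nonempty_approxSeq
  have hirr : Irrational ζ := hζ.1.irrational
  exact ⟨csSup_eq_of_forall (fun _ => s.le_three_of_mem_whSet hirr)
      fun _ => mem_whSet_of_lt_three hζ.1,
    csSup_eq_of_forall (fun _ => s.le_third_of_mem_lamhSet hirr)
      fun _ => mem_lamhSet_of_lt_third⟩
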